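/- arXiv:2207.01591 — 3 statements merged into one kernel-verified Lean document; each statement's English description precedes it below -/
import Mathlib

section
/- For every k there is a constant c_k such that the following holds. Let α₁, …, α_r : G^k → 𝔽₂ be multilinear forms, each symmetric in its first two variables, and let M, R₀ ≥ 1. Then there exist a positive integer R with R₀ ≤ R ≤ (2R₀ + 1)^{(c_k·M)^{2r}} and subspaces Λ ≤ Λ^{×2} ≤ 𝔽₂^r such that: (i) if λ ∈ Λ then prank(λ·α) ≤ R, and if λ ∉ Λ then prank(λ·α) ≥ (2R + 1)^M; (ii) if λ ∈ Λ^{×2} then prank(λ·α^{×2}) ≤ R, and if λ ∉ Λ^{×2} then prank(λ·α^{×2}) ≥ (2R + 1)^M. Here λ·α = Σ_{i∈[r]} λ_i α_i and λ·α^{×2} = Σ_{i∈[r]} λ_i α_i^{×2}. -/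
open Finset

/-- `β : (Fin k → V) → ZMod 2` is a multilinear form in the variables indexed by `S`:
it depends only on the coordinates in `S` and is additive (hence `𝔽₂`-linear) in each of
those coordinates. -/
def MultilinearOn {V : Type*} [AddCommGroup V] [Module (ZMod 2) V] (k : ℕ)
    (S : Finset (Fin k)) (β : (Fin k → V) → ZMod 2) : Prop :=
  (∀ x y : Fin k → V, (∀ i ∈ S, x i = y i) → β x = β y) ∧
  (∀ i ∈ S, ∀ (x : Fin k → V) (u v : V),
    β (Function.update x i (u + v)) = β (Function.update x i u) + β (Function.update x i v))

/-- A multilinear form in all `k` variables. -/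
def IsMultilinear {V : Type*} [AddCommGroup V] [Module (ZMod 2) V] (k : ℕ)
    (α : (Fin k → V) → ZMod 2) : Prop :=
  MultilinearOn k Finset.univ α

/-- `α`, a multilinear form in the variables indexed by `S`, admits a partition-rank
decomposition with `m` terms. -/
def PrankDecompOn {V : Type*} [AddCommGroup V] [Module (ZMod 2) V] (k : ℕ)
    (S : Finset (Fin k)) (m : ℕ) (α : (Fin k → V) → ZMod 2) : Prop :=
  ∃ (I : Fin m → Finset (Fin k)) (β γ : Fin m → ((Fin k → V) → ZMod 2)),
    (∀ i, I i ⊆ S) ∧ (∀ i, I i ≠ ∅) ∧ (∀ i, I i ≠ S) ∧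
    (∀ i, MultilinearOn k (I i) (β i)) ∧
    (∀ i, MultilinearOn k (S \ I i) (γ i)) ∧
    (∀ x, α x = ∑ i, β i x * γ i x)

/-- The partition rank of a multilinear form in the variables indexed by `S`. -/
noncomputable def prankOn {V : Type*} [AddCommGroup V] [Module (ZMod 2) V] (k : ℕ)
    (S : Finset (Fin k)) (α : (Fin k → V) → ZMod 2) : ℕ :=
  sInf {m | PrankDecompOn k S m α}

/-- The partition rank of a multilinear form in `k` variables. -/
noncomputable def prank {V : Type*} [AddCommGroup V] [Module (ZMod 2) V] (k : ℕ)
    (α : (Fin k → V) → ZMod 2) : ℕ :=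
  prankOn k Finset.univ α

/-- `α ∘ π`: the form `(x₁, …, x_k) ↦ α(x_{π⁻¹(1)}, …, x_{π⁻¹(k)})`. -/
def permForm {V : Type*} (k : ℕ) (π : Equiv.Perm (Fin k))
    (α : (Fin k → V) → ZMod 2) : (Fin k → V) → ZMod 2 :=
  fun x => α (fun i => x (π.symm i))

/-- `α` is symmetric in its first `m` variables (0-indexed: coordinates `< m`). -/
def SymmetricInFirst {V : Type*} (k m : ℕ) (α : (Fin k → V) → ZMod 2) : Prop :=
  ∀ i j : Fin k, (i : ℕ) < m → (j : ℕ) < m → permForm k (Equiv.swap i j) α = α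

/-- `α` is symmetric in all of its variables. -/
def SymmetricForm {V : Type*} (k : ℕ) (α : (Fin k → V) → ZMod 2) : Prop :=
  ∀ π : Equiv.Perm (Fin k), permForm k π α = α

/-- `σ` is strongly symmetric: it is symmetric, and the form
`(x, y₃, …, y_k) ↦ σ(x, x, y₃, …, y_k)` is also symmetric.  (Given the symmetry of `σ`,
the latter is equivalent to being allowed to swap the doubled variable with the third
variable, which is how it is stated here.) -/
def StronglySymmetric {V : Type*} (k : ℕ) (σ : (Fin k → V) → ZMod 2) : Prop :=
  SymmetricForm k σ ∧
  ∀ (u v : V) (z : Fin k → V),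
    σ (fun i => if (i : ℕ) = 0 ∨ (i : ℕ) = 1 then u else if (i : ℕ) = 2 then v else z i) =
    σ (fun i => if (i : ℕ) = 0 ∨ (i : ℕ) = 1 then v else if (i : ℕ) = 2 then u else z i)

section Multilinear

variable {V : Type*} [AddCommGroup V] [Module (ZMod 2) V] {k : ℕ}

theorem MultilinearOn.update_of_notMem {S : Finset (Fin k)} {β : (Fin k → V) → ZMod 2}
    (h : MultilinearOn k S β) {i : Fin k} (hi : i ∉ S) (x : Fin k → V) (u : V) :
    β (Function.update x i u) = β x :=
  h.1 _ _ fun j hj => Function.update_of_ne (by rintro rfl; exact hi hj) _ _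

theorem MultilinearOn.mul {S T : Finset (Fin k)} {β γ : (Fin k → V) → ZMod 2}
    (hST : Disjoint S T) (hβ : MultilinearOn k S β) (hγ : MultilinearOn k T γ) :
    MultilinearOn k (S ∪ T) (β * γ) := by
  refine ⟨fun x y hxy => ?_, fun i hi x u v => ?_⟩
  · simp only [Pi.mul_apply]
    rw [hβ.1 x y fun i hi => hxy i (mem_union_left _ hi),
      hγ.1 x y fun i hi => hxy i (mem_union_right _ hi)]
  · simp only [Pi.mul_apply]
    rcases mem_union.1 hi with hi | hi
    · have hT : i ∉ T := disjoint_left.1 hST hi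
      rw [hβ.2 i hi, hγ.update_of_notMem hT, hγ.update_of_notMem hT, hγ.update_of_notMem hT]
      ring
    · have hS : i ∉ S := disjoint_right.1 hST hi
      rw [hγ.2 i hi, hβ.update_of_notMem hS, hβ.update_of_notMem hS, hβ.update_of_notMem hS]
      ring

theorem multilinearOn_one : MultilinearOn k ∅ (1 : (Fin k → V) → ZMod 2) :=
  ⟨fun _ _ _ => rfl, fun i hi => absurd hi (notMem_empty i)⟩

theorem MultilinearOn.sum {ι : Type*} [Fintype ι] {S : Finset (Fin k)}
    {β : ι → (Fin k → V) → ZMod 2} (h : ∀ i, MultilinearOn k S (β i)) :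
    MultilinearOn k S (∑ i, β i) := by
  refine ⟨fun x y hxy => ?_, fun i hi x u v => ?_⟩
  · simp only [Finset.sum_apply]
    exact sum_congr rfl fun j _ => (h j).1 x y hxy
  · simp only [Finset.sum_apply, ← sum_add_distrib]
    exact sum_congr rfl fun j _ => (h j).2 i hi x u v

theorem MultilinearOn.add {S : Finset (Fin k)} {β γ : (Fin k → V) → ZMod 2}
    (hβ : MultilinearOn k S β) (hγ : MultilinearOn k S γ) : MultilinearOn k S (β + γ) := by
  refine ⟨fun x y hxy => ?_, fun i hi x u v => ?_⟩
  · simp only [Pi.add_apply]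
    rw [hβ.1 x y hxy, hγ.1 x y hxy]
  · simp only [Pi.add_apply]
    rw [hβ.2 i hi, hγ.2 i hi]
    ring

/-- Freeze the coordinates outside `B` at their values in `p`. -/
def freeze (B : Finset (Fin k)) (p : Fin k → V) (f : (Fin k → V) → ZMod 2) :
    (Fin k → V) → ZMod 2 :=
  fun x => f (B.piecewise x p)

theorem MultilinearOn.freeze {S : Finset (Fin k)} {β : (Fin k → V) → ZMod 2}
    (h : MultilinearOn k S β) (B : Finset (Fin k)) (p : Fin k → V) :
    MultilinearOn k (S ∩ B) (freeze B p β) := by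
  refine ⟨fun x y hxy => h.1 _ _ fun i hi => ?_, fun i hi x u v => ?_⟩
  · by_cases hB : i ∈ B
    · simp [hB, hxy i (mem_inter.2 ⟨hi, hB⟩)]
    · simp [hB]
  · have hi := mem_inter.1 hi
    have key : ∀ w, B.piecewise (Function.update x i w) p =
        Function.update (B.piecewise x p) i w := fun w => by
      ext1 j
      by_cases hj : j = i
      · subst hj; simp [hi.2]
      · by_cases hB : j ∈ B <;> simp [hB, hj]
    simp only [_root_.freeze, key]
    exact h.2 i hi.1 _ u v

/-- Exchange the coordinates `a` and `b`. -/
def swapVars (a b : Fin k) (f : (Fin k → V) → ZMod 2) : (Fin k → V) → ZMod 2 :=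
  fun x => f fun i => x (Equiv.swap a b i)

omit [AddCommGroup V] [Module (ZMod 2) V] in
theorem swapVars_swapVars (a b : Fin k) (f : (Fin k → V) → ZMod 2) :
    swapVars a b (swapVars a b f) = f := by
  funext x
  simp [swapVars]

theorem MultilinearOn.swapVars {S T : Finset (Fin k)} {β : (Fin k → V) → ZMod 2} {a b : Fin k}
    (h : MultilinearOn k S β) (hT : ∀ i, i ∈ T ↔ Equiv.swap a b i ∈ S) :
    MultilinearOn k T (swapVars a b β) := by
  refine ⟨fun x y hxy => h.1 _ _ fun i hi => hxy _ ((hT _).2 (by simpa using hi)),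
    fun i hi x u v => ?_⟩
  have key : ∀ w, (fun j => Function.update x i w (Equiv.swap a b j)) =
      Function.update (fun j => x (Equiv.swap a b j)) (Equiv.swap a b i) w := fun w => by
    ext1 j
    by_cases hj : j = Equiv.swap a b i
    · subst hj; simp
    · have : Equiv.swap a b j ≠ i := fun e => hj (by rw [← e]; simp)
      simp [hj, this]
  simp only [_root_.swapVars, key]
  exact h.2 _ ((hT i).1 hi) _ u v

end Multilinear

section SumOf

variable {W : Type*}

/-- `f` is a sum of at most `N` functions satisfying `P`. -/
def SumOf (P : (W → ZMod 2) → Prop) (N : ℕ) (f : W → ZMod 2) : Prop :=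
  ∃ (ι : Type) (_ : Fintype ι) (t : ι → W → ZMod 2),
    Fintype.card ι ≤ N ∧ (∀ i, P (t i)) ∧ f = ∑ i, t i

variable {P Q : (W → ZMod 2) → Prop} {N M : ℕ} {f g : W → ZMod 2}

theorem SumOf.mono (h : SumOf P N f) (hPQ : ∀ f, P f → Q f) (hNM : N ≤ M) : SumOf Q M f := by
  obtain ⟨ι, _, t, hc, ht, rfl⟩ := h
  exact ⟨ι, _, t, hc.trans hNM, fun i => hPQ _ (ht i), rfl⟩

theorem SumOf.zero : SumOf P N 0 :=
  ⟨Empty, inferInstance, Empty.elim, by simp, fun i => i.elim, by simp⟩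

theorem SumOf.single (h : P f) : SumOf P 1 f :=
  ⟨Unit, inferInstance, fun _ => f, by simp, fun _ => h, by simp⟩

theorem SumOf.add (hf : SumOf P N f) (hg : SumOf P M g) : SumOf P (N + M) (f + g) := by
  obtain ⟨ι, _, t, hc, ht, rfl⟩ := hf
  obtain ⟨κ, _, s, hd, hs, rfl⟩ := hg
  refine ⟨ι ⊕ κ, inferInstance, Sum.elim t s, ?_, ?_, ?_⟩
  · rw [Fintype.card_sum]; omega
  · rintro (i | i)
    · exact ht i
    · exact hs i
  · simp

theorem SumOf.sum {ι : Type} [Fintype ι] {t : ι → W → ZMod 2} (hc : Fintype.card ι ≤ N)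
    (h : ∀ i, SumOf P M (t i)) : SumOf P (N * M) (∑ i, t i) := by
  choose κ inst s hd hs hts using h
  refine ⟨Σ i, κ i, inferInstance, fun x => s x.1 x.2, ?_, fun x => hs _ _, ?_⟩
  · rw [Fintype.card_sigma]
    calc ∑ i, Fintype.card (κ i) ≤ ∑ _i : ι, M := sum_le_sum fun i _ => hd i
      _ = Fintype.card ι * M := by simp
      _ ≤ N * M := Nat.mul_le_mul_right _ hc
  · rw [Fintype.sum_sigma]
    exact sum_congr rfl fun i _ => hts i

theorem SumOf.map {W' : Type*} {Q : (W' → ZMod 2) → Prop} (h : SumOf P N f)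
    (Φ : (W → ZMod 2) →+ (W' → ZMod 2)) (hΦ : ∀ f, P f → SumOf Q M (Φ f)) :
    SumOf Q (N * M) (Φ f) := by
  obtain ⟨ι, _, t, hc, ht, rfl⟩ := h
  rw [map_sum]
  exact SumOf.sum hc fun i => hΦ _ (ht i)

theorem SumOf.split (h : SumOf (fun f => P f ∨ Q f) N f) :
    ∃ g h, f = g + h ∧ SumOf P N g ∧ SumOf Q N h := by
  classical
  obtain ⟨ι, _, t, hc, ht, rfl⟩ := h
  refine ⟨∑ i : {i // P (t i)}, t i, ∑ i : {i // ¬ P (t i)}, t i, ?_, ?_, ?_⟩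
  · exact (Fintype.sum_subtype_add_sum_subtype (fun i => P (t i)) t).symm
  · exact ⟨{i // P (t i)}, inferInstance, fun i => t i, (Fintype.card_subtype_le _).trans hc,
      fun i => i.2, rfl⟩
  · exact ⟨{i // ¬ P (t i)}, inferInstance, fun i => t i, (Fintype.card_subtype_le _).trans hc,
      fun i => (ht i).resolve_left i.2, rfl⟩

/-- Finitely many functions with values in `𝔽₂` can be reconstructed by interpolation from at most
as many points. -/
theorem exists_interpolation {ι : Type} [Fintype ι] (A : ι → W → ZMod 2) :
    ∃ (κ : Type) (_ : Fintype κ) (p : κ → W) (e : κ → W → ZMod 2),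
      Fintype.card κ ≤ Fintype.card ι ∧ (∀ t, e t ∈ Submodule.span (ZMod 2) (Set.range A)) ∧
      ∀ i, A i = ∑ t, A i (p t) • e t := by
  classical
  suffices h : ∀ s : Finset ι, ∃ (m : ℕ) (p : Fin m → W) (e : Fin m → W → ZMod 2),
      m ≤ s.card ∧ (∀ t, e t ∈ Submodule.span (ZMod 2) (Set.range A)) ∧
      (∀ t u, e t (p u) = if t = u then 1 else 0) ∧
      ∀ i ∈ s, A i = ∑ t, A i (p t) • e t by
    obtain ⟨m, p, e, hm, he, -, hA⟩ := h univ
    exact ⟨Fin m, inferInstance, p, e, by simpa using hm, he, fun i => hA i (mem_univ i)⟩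
  intro s
  induction s using Finset.induction_on with
  | empty => exact ⟨0, Fin.elim0, Fin.elim0, by simp, fun t => t.elim0, fun t => t.elim0, by simp⟩
  | insert j s hj ih =>
    obtain ⟨m, p, e, hm, he, hd, hA⟩ := ih
    set g : W → ZMod 2 := A j - ∑ t, A j (p t) • e t with hg
    have hgs : g ∈ Submodule.span (ZMod 2) (Set.range A) :=
      Submodule.sub_mem _ (Submodule.subset_span ⟨j, rfl⟩)
        (Submodule.sum_mem _ fun t _ => Submodule.smul_mem _ _ (he t))
    by_cases h0 : g = 0
    · refine ⟨m, p, e, hm.trans (card_le_card (subset_insert _ _)), he, hd, fun i hi => ?_⟩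
      rcases mem_insert.1 hi with rfl | hi
      · exact sub_eq_zero.1 h0
      · exact hA i hi
    · obtain ⟨w, hw⟩ := Function.ne_iff.1 h0
      have hw1 : g w = 1 := by
        have : ∀ z : ZMod 2, z ≠ 0 → z = 1 := by decide
        exact this _ hw
      have hgp : ∀ u, g (p u) = 0 := fun u => by
        simp [hg, Finset.sum_apply, hd]
      refine ⟨m + 1, Fin.snoc p w, Fin.snoc (fun t => e t - e t w • g) g, ?_, ?_, ?_, ?_⟩
      · rw [card_insert_of_notMem hj]; omega
      · intro t
        refine Fin.lastCases ?_ (fun t => ?_) t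
        · simpa using hgs
        · simpa using Submodule.sub_mem _ (he t) (Submodule.smul_mem _ (e t w) hgs)
      · intro t u
        refine Fin.lastCases ?_ (fun t => ?_) t <;> refine Fin.lastCases ?_ (fun u => ?_) u
        · simp [hw1]
        · simp [hgp, (Fin.castSucc_lt_last u).ne']
        · simp [hw1, (Fin.castSucc_lt_last t).ne]
        · simp [hgp, hd]
      · have key : ∀ f : W → ZMod 2, f w = (∑ t, f (p t) • e t) w + (f - ∑ t, f (p t) • e t) w := by
          intro f; simp
        have expand : ∀ f : W → ZMod 2,
            ∑ t, f ((Fin.snoc p w : Fin (m + 1) → W) t) •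
              (Fin.snoc (fun t => e t - e t w • g) g : Fin (m + 1) → W → ZMod 2) t =
            (∑ t, f (p t) • e t) + ((f - ∑ t, f (p t) • e t) w) • g := by
          intro f
          rw [Fin.sum_univ_castSucc]
          simp only [Fin.snoc_castSucc, Fin.snoc_last, smul_sub, sum_sub_distrib, Pi.sub_apply,
            Finset.sum_apply, Pi.smul_apply, smul_eq_mul, sub_smul, sum_smul, smul_smul]
          abel
        intro i hi
        rw [expand]
        rcases mem_insert.1 hi with rfl | hi
        · rw [← hg, hw1, one_smul, hg]
          abel
        · rw [← hA i hi]
          simp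

theorem SumOf.of_mem_span {ι : Type} [Fintype ι] {A : ι → W → ZMod 2} (hA : ∀ i, P (A i))
    (hf : f ∈ Submodule.span (ZMod 2) (Set.range A)) : SumOf P (Fintype.card ι) f := by
  classical
  obtain ⟨c, rfl⟩ := (Submodule.mem_span_range_iff_exists_fun _).1 hf
  rw [← mul_one (Fintype.card ι)]
  refine SumOf.sum le_rfl fun i => ?_
  have : ∀ z : ZMod 2, z = 0 ∨ z = 1 := by decide
  rcases this (c i) with h | h
  · rw [h, zero_smul]; exact SumOf.zero
  · rw [h, one_smul]; exact SumOf.single (hA i)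

end SumOf

section Reduction

variable {V : Type*} [AddCommGroup V] [Module (ZMod 2) V] {k : ℕ} {a b : Fin k} {N : ℕ}

theorem add_self_zmod_two {W : Type*} (f : W → ZMod 2) : f + f = 0 :=
  funext fun x => CharTwo.add_self_eq_zero (f x)

theorem exists_freeze_decomposition (B : Finset (Fin k)) {P : ((Fin k → V) → ZMod 2) → Prop}
    (hP : ∀ A, P A → MultilinearOn k Bᶜ A) {g : (Fin k → V) → ZMod 2}
    (hg : SumOf (fun f => ∃ A F, P A ∧ MultilinearOn k B F ∧ f = A * F) N g) :
    ∃ (κ : Type) (_ : Fintype κ) (p : κ → Fin k → V) (e : κ → (Fin k → V) → ZMod 2),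
      Fintype.card κ ≤ N ∧ (∀ t, SumOf P N (e t)) ∧ g = ∑ t, e t * freeze B (p t) g := by
  obtain ⟨ι, _, t, hc, ht, rfl⟩ := hg
  choose A F hA hF hAF using ht
  obtain ⟨κ, _, p, e, hκ, he, hrep⟩ := exists_interpolation A
  refine ⟨κ, _, p, e, hκ.trans hc,
    fun s => (SumOf.of_mem_span hA (he s)).mono (fun _ h => h) hc, ?_⟩
  have hfr : ∀ (s : κ) (i : ι) (x : Fin k → V),
      t i (B.piecewise x (p s)) = A i (p s) * F i x := fun s i x => by
    rw [hAF i, Pi.mul_apply]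
    congr 1
    · exact (hP _ (hA i)).1 _ _ fun j hj => by simp [mem_compl.1 hj]
    · exact (hF i).1 _ _ fun j hj => by simp [hj]
  funext x
  simp only [Finset.sum_apply, Pi.mul_apply, freeze, hfr, mul_sum]
  rw [sum_comm]
  refine sum_congr rfl fun i _ => ?_
  rw [hAF i, Pi.mul_apply]
  conv_lhs => rw [hrep i]
  simp only [Finset.sum_apply, Pi.smul_apply, smul_eq_mul, sum_mul]
  exact sum_congr rfl fun s _ => by ring

/-- A term with the variables `a` and `b` in a common factor, which is symmetric in them. -/
def GoodTerm (a b : Fin k) (f : (Fin k → V) → ZMod 2) : Prop :=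
  ∃ (J : Finset (Fin k)) (S G : (Fin k → V) → ZMod 2), J.Nonempty ∧ a ∉ J ∧ b ∉ J ∧
    MultilinearOn k Jᶜ S ∧ swapVars a b S = S ∧ MultilinearOn k J G ∧ f = S * G

/-- A term with the variables `a` and `b` in a common factor, the other variables of which form
a member of `𝓘`. -/
def SameTerm (a b : Fin k) (𝓘 : Finset (Finset (Fin k))) (f : (Fin k → V) → ZMod 2) : Prop :=
  ∃ I ∈ 𝓘, ∃ S G : (Fin k → V) → ZMod 2, MultilinearOn k (insert a (insert b I)) S ∧
    MultilinearOn k (insert a (insert b I))ᶜ G ∧ f = S * G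

/-- A term with the variables `a` and `b` in different factors, the other variables of which form
members of `𝓘` and `𝓙` respectively. -/
def SepTerm (a b : Fin k) (𝓘 𝓙 : Finset (Finset (Fin k))) (f : (Fin k → V) → ZMod 2) : Prop :=
  ∃ I ∈ 𝓘, ∃ J ∈ 𝓙, Disjoint (insert a I) (insert b J) ∧ ∃ P Q G : (Fin k → V) → ZMod 2,
    MultilinearOn k (insert a I) P ∧ MultilinearOn k (insert b J) Q ∧
    MultilinearOn k (insert a I ∪ insert b J)ᶜ G ∧ f = P * Q * G

theorem SepTerm.mono {𝓘 𝓙 𝓘' 𝓙' : Finset (Finset (Fin k))} (h𝓘 : 𝓘 ⊆ 𝓘') (h𝓙 : 𝓙 ⊆ 𝓙')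
    {f : (Fin k → V) → ZMod 2} (hf : SepTerm a b 𝓘 𝓙 f) : SepTerm a b 𝓘' 𝓙' f := by
  obtain ⟨I, hI, J, hJ, h⟩ := hf
  exact ⟨I, h𝓘 hI, J, h𝓙 hJ, h⟩

theorem MultilinearOn.mul_univ {S T : Finset (Fin k)} {β γ : (Fin k → V) → ZMod 2}
    (hST : IsCompl S T) (hβ : MultilinearOn k S β) (hγ : MultilinearOn k T γ) :
    IsMultilinear k (β * γ) := by
  have h := hβ.mul hST.disjoint hγ
  rwa [show S ∪ T = univ from hST.sup_eq_top] at h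

theorem GoodTerm.isMultilinear {f : (Fin k → V) → ZMod 2} (h : GoodTerm a b f) :
    IsMultilinear k f := by
  obtain ⟨J, S, G, -, -, -, hS, -, hG, rfl⟩ := h
  exact hS.mul_univ isCompl_compl.symm hG

theorem SepTerm.isMultilinear {𝓘 𝓙 : Finset (Finset (Fin k))} {f : (Fin k → V) → ZMod 2}
    (h : SepTerm a b 𝓘 𝓙 f) : IsMultilinear k f := by
  obtain ⟨I, -, J, -, hIJ, P, Q, G, hP, hQ, hG, rfl⟩ := h
  exact (hP.mul hIJ hQ).mul_univ isCompl_compl hG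

theorem SumOf.isMultilinear {P : ((Fin k → V) → ZMod 2) → Prop} {f : (Fin k → V) → ZMod 2}
    (h : SumOf P N f) (hP : ∀ f, P f → IsMultilinear k f) : IsMultilinear k f := by
  obtain ⟨ι, _, t, -, ht, rfl⟩ := h
  exact MultilinearOn.sum fun i => hP _ (ht i)

omit [AddCommGroup V] [Module (ZMod 2) V] in
theorem swapVars_add (f g : (Fin k → V) → ZMod 2) :
    swapVars a b (f + g) = swapVars a b f + swapVars a b g := rfl

omit [AddCommGroup V] [Module (ZMod 2) V] in
theorem swapVars_sum {ι : Type*} [Fintype ι] (t : ι → (Fin k → V) → ZMod 2) :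
    swapVars a b (∑ i, t i) = ∑ i, swapVars a b (t i) := by
  funext x
  simp [swapVars, Finset.sum_apply]

theorem MultilinearOn.swapVars_eq {S : Finset (Fin k)} {f : (Fin k → V) → ZMod 2}
    (h : MultilinearOn k S f) (ha : a ∉ S) (hb : b ∉ S) : _root_.swapVars a b f = f :=
  funext fun x => h.1 _ _ fun i hi => by
    rw [Equiv.swap_apply_of_ne_of_ne] <;> rintro rfl <;> contradiction

theorem GoodTerm.swapVars_eq {f : (Fin k → V) → ZMod 2} (h : GoodTerm a b f) :
    swapVars a b f = f := by
  obtain ⟨J, S, G, -, ha, hb, -, hS, hG, rfl⟩ := h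
  conv_rhs => rw [← hS, ← hG.swapVars_eq ha hb]
  rfl

theorem SumOf.swapVars_eq {f : (Fin k → V) → ZMod 2} (h : SumOf (GoodTerm a b) N f) :
    swapVars a b f = f := by
  obtain ⟨ι, _, t, -, ht, rfl⟩ := h
  rw [swapVars_sum]
  exact sum_congr rfl fun i _ => (ht i).swapVars_eq

/-- Multiply by `e` after freezing the coordinates outside `B`, as an additive map. -/
def mulFreeze (B : Finset (Fin k)) (p : Fin k → V) (e : (Fin k → V) → ZMod 2) :
    ((Fin k → V) → ZMod 2) →+ ((Fin k → V) → ZMod 2) where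
  toFun f := e * freeze B p f
  map_zero' := funext fun _ => mul_zero _
  map_add' _ _ := funext fun _ => mul_add _ _ _

theorem SameTerm.mulFreeze {𝓘 : Finset (Finset (Fin k))}
    (h𝓘 : ∀ I ∈ 𝓘, ∀ J ⊆ I, J ∈ 𝓘) {f : (Fin k → V) → ZMod 2} (hf : SameTerm a b 𝓘 f)
    {B : Finset (Fin k)} (ha : a ∈ B) (hb : b ∈ B) (p : Fin k → V) {e : (Fin k → V) → ZMod 2}
    (he : MultilinearOn k Bᶜ e) : SameTerm a b 𝓘 (mulFreeze B p e f) := by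
  obtain ⟨I, hI, S, G, hS, hG, rfl⟩ := hf
  refine ⟨I ∩ B, h𝓘 I hI _ inter_subset_left, freeze B p S, e * freeze B p G, ?_, ?_, ?_⟩
  · have := hS.freeze B p
    rwa [insert_inter_of_mem ha, insert_inter_of_mem hb] at this
  · have := he.mul (disjoint_compl_left.mono_right inter_subset_right) (hG.freeze B p)
    convert this using 1
    ext i
    simp only [mem_compl, mem_insert, mem_inter, mem_union, not_or, not_and]
    by_cases hi : i ∈ B
    · simp [hi]
    · have h1 : i ≠ a := by rintro rfl; exact hi ha
      have h2 : i ≠ b := by rintro rfl; exact hi hb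
      simp [hi, h1, h2]
  · exact funext fun x => mul_left_comm _ _ _

theorem SepTerm.mulFreeze {𝓘 𝓙 : Finset (Finset (Fin k))}
    (h𝓘 : ∀ I ∈ 𝓘, ∀ J ⊆ I, J ∈ 𝓘) (h𝓙 : ∀ I ∈ 𝓙, ∀ J ⊆ I, J ∈ 𝓙)
    {f : (Fin k → V) → ZMod 2} (hf : SepTerm a b 𝓘 𝓙 f)
    {B : Finset (Fin k)} (ha : a ∈ B) (hb : b ∈ B) (p : Fin k → V) {e : (Fin k → V) → ZMod 2}
    (he : MultilinearOn k Bᶜ e) : SepTerm a b 𝓘 𝓙 (mulFreeze B p e f) := by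
  obtain ⟨I, hI, J, hJ, hIJ, P, Q, G, hP, hQ, hG, rfl⟩ := hf
  have hP' := hP.freeze B p
  have hQ' := hQ.freeze B p
  rw [insert_inter_of_mem ha] at hP'
  rw [insert_inter_of_mem hb] at hQ'
  refine ⟨I ∩ B, h𝓘 I hI _ inter_subset_left, J ∩ B, h𝓙 J hJ _ inter_subset_left,
    hIJ.mono (insert_subset_insert _ inter_subset_left) (insert_subset_insert _ inter_subset_left),
    freeze B p P, freeze B p Q, e * freeze B p G, hP', hQ', ?_, ?_⟩
  · have := he.mul (disjoint_compl_left.mono_right inter_subset_right) (hG.freeze B p)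
    convert this using 1
    rw [← insert_inter_of_mem ha, ← insert_inter_of_mem hb]
    ext i
    simp only [mem_compl, mem_inter, mem_union]
    tauto
  · exact funext fun x => mul_left_comm (e x) (freeze B p P x * freeze B p Q x) (freeze B p G x)

omit [AddCommGroup V] [Module (ZMod 2) V] in
theorem swapVars_freeze {B : Finset (Fin k)} (ha : a ∈ B) (hb : b ∈ B) (p : Fin k → V)
    (f : (Fin k → V) → ZMod 2) : swapVars a b (freeze B p f) = freeze B p (swapVars a b f) := by
  funext x
  simp only [swapVars, freeze]
  congr 1
  funext i
  rcases eq_or_ne i a with rfl | h1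
  · simp [ha, hb]
  rcases eq_or_ne i b with rfl | h2
  · simp [ha, hb]
  · simp [Finset.piecewise, Equiv.swap_apply_of_ne_of_ne h1 h2]

/-- Terms in which `a` and `b` share a factor with a maximal set `I₀` of other variables can be
replaced by finer ones. -/
theorem exists_reduction_same {𝓘 𝓙 : Finset (Finset (Fin k))}
    (h𝓙 : ∀ I ∈ 𝓙, ∀ J ⊆ I, J ∈ 𝓙) {I₀ : Finset (Fin k)}
    (h𝓘 : ∀ I ∈ 𝓘.erase I₀, ∀ J ⊆ I, J ∈ 𝓘.erase I₀)
    (hI₀ : insert a (insert b I₀) ≠ univ) {α : (Fin k → V) → ZMod 2} (hα : IsMultilinear k α)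
    (hs : swapVars a b α = α) (h : SumOf (fun f => SameTerm a b 𝓘 f ∨ SepTerm a b 𝓙 𝓙 f) N α) :
    ∃ G α', α = G + α' ∧ SumOf (GoodTerm a b) N G ∧
      SumOf (fun f => SameTerm a b (𝓘.erase I₀) f ∨ SepTerm a b 𝓙 𝓙 f) (N * N + N) α' := by
  set B := insert a (insert b I₀) with hB
  have haB : a ∈ B := by simp [hB]
  have hbB : b ∈ B := by simp [hB]
  have h' : SumOf (fun f => (∃ A F, MultilinearOn k Bᶜ A ∧ MultilinearOn k B F ∧ f = A * F) ∨
      (SameTerm a b (𝓘.erase I₀) f ∨ SepTerm a b 𝓙 𝓙 f)) N α := by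
    refine h.mono ?_ le_rfl
    rintro f (⟨I, hI, S, G, hS, hG, rfl⟩ | hf)
    · by_cases hII : I = I₀
      · subst hII
        exact Or.inl ⟨G, S, hG, hS, mul_comm _ _⟩
      · exact Or.inr (Or.inl ⟨I, mem_erase.2 ⟨hII, hI⟩, S, G, hS, hG, rfl⟩)
    · exact Or.inr (Or.inr hf)
  obtain ⟨g, r, hgr, hg, hr⟩ := h'.split
  obtain ⟨κ, _, p, e, hκ, he, hrep⟩ := exists_freeze_decomposition B (fun _ h => h) hg
  have heML : ∀ t, MultilinearOn k Bᶜ (e t) := fun t => by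
    obtain ⟨ι, _, s, -, hs, h⟩ := he t
    exact h ▸ MultilinearOn.sum hs
  refine ⟨∑ t, mulFreeze B (p t) (e t) α, (∑ t, mulFreeze B (p t) (e t) r) + r, ?_,
    ⟨κ, _, _, hκ, fun t => ?_, rfl⟩, ?_⟩
  · rw [← add_assoc, ← sum_add_distrib]
    have : ∀ t, mulFreeze B (p t) (e t) α + mulFreeze B (p t) (e t) r =
        e t * freeze B (p t) g := fun t => by
      rw [hgr, map_add, add_assoc, add_self_zmod_two, add_zero]
      rfl
    simp only [this]
    rw [← hrep, hgr]
  · refine ⟨Bᶜ, freeze B (p t) α, e t, ?_, by simpa using haB, by simpa using hbB, ?_, ?_, heML t,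
      mul_comm _ _⟩
    · rwa [nonempty_iff_ne_empty, Ne, compl_eq_empty_iff]
    · have := hα.freeze B (p t)
      rw [univ_inter] at this
      rwa [compl_compl]
    · rw [swapVars_freeze haB hbB, hs]
  · refine SumOf.add (SumOf.sum hκ fun t => ?_) hr
    refine (hr.map (mulFreeze B (p t) (e t)) (M := 1) fun f hf => SumOf.single ?_).mono
      (fun _ h => h) (mul_one N).le
    exact hf.imp (fun h => h.mulFreeze h𝓘 haB hbB (p t) (heML t))
      fun h => h.mulFreeze h𝓙 h𝓙 haB hbB (p t) (heML t)

theorem SepTerm.swapVars {𝓘 𝓙 : Finset (Finset (Fin k))} (h𝓘 : ∀ I ∈ 𝓘, a ∉ I)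
    (h𝓙 : ∀ J ∈ 𝓙, b ∉ J) {f : (Fin k → V) → ZMod 2} (hf : SepTerm a b 𝓘 𝓙 f) :
    SepTerm a b 𝓙 𝓘 (swapVars a b f) := by
  obtain ⟨I, hI, J, hJ, hIJ, P, Q, G, hP, hQ, hG, rfl⟩ := hf
  have haI := h𝓘 I hI
  have hbJ := h𝓙 J hJ
  have hab : a ≠ b := by
    rintro rfl
    exact disjoint_left.1 hIJ (mem_insert_self _ _) (mem_insert_self _ _)
  have hbI : b ∉ I := fun h =>
    disjoint_left.1 hIJ (mem_insert_of_mem h) (mem_insert_self _ _)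
  have haJ : a ∉ J := fun h =>
    disjoint_left.1 hIJ (mem_insert_self _ _) (mem_insert_of_mem h)
  have hJa : ∀ i, i ∈ insert a J ↔ Equiv.swap a b i ∈ insert b J := fun i => by
    rcases eq_or_ne i a with rfl | h1
    · simp
    rcases eq_or_ne i b with rfl | h2
    · simp [hab, hab.symm, haJ, hbJ]
    · simp [Equiv.swap_apply_of_ne_of_ne h1 h2, h1, h2]
  have hIb : ∀ i, i ∈ insert b I ↔ Equiv.swap a b i ∈ insert a I := fun i => by
    rcases eq_or_ne i a with rfl | h1
    · simp [hab, hab.symm, haI, hbI]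
    rcases eq_or_ne i b with rfl | h2
    · simp
    · simp [Equiv.swap_apply_of_ne_of_ne h1 h2, h1, h2]
  refine ⟨J, hJ, I, hI, ?_, _root_.swapVars a b Q, _root_.swapVars a b P,
    _root_.swapVars a b G, hQ.swapVars hJa, hP.swapVars hIb, hG.swapVars fun i => ?_, ?_⟩
  · simp only [disjoint_left] at hIJ ⊢
    intro i h1 h2
    exact hIJ ((hIb i).1 h2) ((hJa i).1 h1)
  · simp only [mem_compl, mem_union, hJa i, hIb i, or_comm]
  · funext x
    simp only [Pi.mul_apply, _root_.swapVars]
    ring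

/-- Terms separating `a` and `b` can be oriented in such a way that `I₀` only occurs on the side
of `a`. -/
theorem exists_orientation {𝓘 : Finset (Finset (Fin k))} (h𝓘 : ∀ I ∈ 𝓘, a ∉ I ∧ b ∉ I)
    {I₀ : Finset (Fin k)} (hI₀ : I₀.Nonempty) {α : (Fin k → V) → ZMod 2}
    (h : SumOf (SepTerm a b 𝓘 𝓘) N α) :
    ∃ g, SumOf (SepTerm a b 𝓘 (𝓘.erase I₀)) (N + N) (α + (g + swapVars a b g)) := by
  have h' : SumOf (fun f => SepTerm a b 𝓘 (𝓘.erase I₀) f ∨ SepTerm a b (𝓘.erase I₀) 𝓘 f) N α := by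
    refine h.mono ?_ le_rfl
    rintro f ⟨I, hI, J, hJ, hIJ, hf⟩
    by_cases hJI : J = I₀
    · refine Or.inr ⟨I, mem_erase.2 ⟨?_, hI⟩, J, hJ, hIJ, hf⟩
      rintro rfl
      obtain ⟨i, hi⟩ := hI₀
      exact disjoint_left.1 hIJ (mem_insert_of_mem hi) (mem_insert_of_mem (hJI ▸ hi))
    · exact Or.inl ⟨I, hI, J, mem_erase.2 ⟨hJI, hJ⟩, hIJ, hf⟩
  obtain ⟨u, w, rfl, hu, hw⟩ := h'.split
  refine ⟨w, ?_⟩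
  rw [show u + w + (w + swapVars a b w) = u + swapVars a b w by
    rw [add_assoc, ← add_assoc w, add_self_zmod_two, zero_add]]
  refine hu.add ?_
  obtain ⟨ι, _, t, hc, ht, rfl⟩ := hw
  rw [swapVars_sum]
  exact ⟨ι, _, _, hc, fun i => (ht i).swapVars (fun I hI => (h𝓘 I (mem_of_mem_erase hI)).1)
    fun I hI => (h𝓘 I hI).2, rfl⟩

/-- The cofactor of a factor in the variable `a` and those in `I₀`. -/
def CofactorTerm (a b : Fin k) (I₀ : Finset (Fin k)) (𝓙 : Finset (Finset (Fin k)))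
    (f : (Fin k → V) → ZMod 2) : Prop :=
  ∃ J ∈ 𝓙, Disjoint (insert a I₀) (insert b J) ∧ ∃ Q G : (Fin k → V) → ZMod 2,
    MultilinearOn k (insert b J) Q ∧ MultilinearOn k (insert a I₀ ∪ insert b J)ᶜ G ∧ f = Q * G

theorem CofactorTerm.multilinearOn {I₀ : Finset (Fin k)} {𝓙 : Finset (Finset (Fin k))}
    {f : (Fin k → V) → ZMod 2} (hf : CofactorTerm a b I₀ 𝓙 f) :
    MultilinearOn k (insert a I₀)ᶜ f := by
  obtain ⟨J, -, hJ, Q, G, hQ, hG, rfl⟩ := hf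
  have := hQ.mul (disjoint_compl_right.mono_left subset_union_right) hG
  convert this using 1
  ext i
  have := fun h : i ∈ insert a I₀ => disjoint_left.1 hJ h
  simp only [mem_compl, mem_union]
  tauto

theorem CofactorTerm.mulFreeze {I₀ : Finset (Fin k)} {𝓘 𝓙 𝓙' : Finset (Finset (Fin k))}
    (h𝓘 : ∀ I ∈ 𝓘, ∀ J ⊆ I, J ∈ 𝓘) {e f : (Fin k → V) → ZMod 2}
    (he : CofactorTerm a b I₀ 𝓙 e) (hf : SepTerm a b 𝓘 𝓙' f) (p : Fin k → V) :
    SepTerm a b 𝓘 𝓙 (mulFreeze (insert a I₀) p e f) := by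
  obtain ⟨J, hJ, hBJ, Q, G, hQ, hG, rfl⟩ := he
  obtain ⟨I', hI', J', -, hIJ', P', Q', G', hP', hQ', hG', rfl⟩ := hf
  have hI : insert a (I' ∩ I₀) = insert a I' ∩ insert a I₀ := insert_inter_distrib _ _ _
  refine ⟨I' ∩ I₀, h𝓘 I' hI' _ inter_subset_left, J, hJ,
    hBJ.mono_left (insert_subset_insert _ inter_subset_right), freeze (insert a I₀) p P', Q,
    freeze (insert a I₀) p Q' * freeze (insert a I₀) p G' * G, ?_, hQ, ?_, ?_⟩
  · rw [hI]
    exact hP'.freeze _ p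
  · rw [hI]
    generalize insert a I₀ = B at *
    generalize insert a I' = C at *
    generalize insert b J = D at *
    generalize insert b J' = E at *
    have h1 := (hQ'.freeze B p).mul (disjoint_compl_right.mono
      (inter_subset_left.trans subset_union_right) inter_subset_left) (hG'.freeze B p)
    have h2 := h1.mul (disjoint_compl_right.mono_left
      ((union_subset inter_subset_right inter_subset_right).trans subset_union_left)) hG
    convert h2 using 1
    ext i
    have h3 := fun h : i ∈ B => disjoint_left.1 hBJ h
    have h4 := fun h : i ∈ C => disjoint_left.1 hIJ' h
    simp only [mem_compl, mem_union, mem_inter]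
    tauto
  · funext x
    simp only [_root_.mulFreeze, AddMonoidHom.coe_mk, ZeroHom.coe_mk, Pi.mul_apply, freeze]
    ring

/-- Terms separating `a` and `b` in which `a` shares a factor with a maximal nonempty set `I₀` of
other variables can be replaced by finer ones. -/
theorem sumOf_sepTerm_erase {𝓘 : Finset (Finset (Fin k))} (hab : ∀ I ∈ 𝓘, a ∉ I ∧ b ∉ I)
    {I₀ : Finset (Fin k)} (h𝓘 : ∀ I ∈ 𝓘.erase I₀, ∀ J ⊆ I, J ∈ 𝓘.erase I₀)
    {α : (Fin k → V) → ZMod 2} (hs : swapVars a b α = α)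
    (h : SumOf (SepTerm a b 𝓘 (𝓘.erase I₀)) N α) :
    SumOf (SepTerm a b (𝓘.erase I₀) (𝓘.erase I₀)) (N * (N * (N + N)) + N) α := by
  set 𝓙 := 𝓘.erase I₀ with h𝓙
  have h𝓙𝓘 : 𝓙 ⊆ 𝓘 := erase_subset _ _
  set B := insert a I₀ with hB
  have h' : SumOf (fun f => (∃ A F, CofactorTerm a b I₀ 𝓙 A ∧ MultilinearOn k B F ∧ f = A * F) ∨
      SepTerm a b 𝓙 𝓙 f) N α := by
    refine h.mono ?_ le_rfl
    rintro f ⟨I, hI, J, hJ, hIJ, P, Q, G, hP, hQ, hG, rfl⟩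
    by_cases hII : I = I₀
    · subst hII
      exact Or.inl ⟨Q * G, P, ⟨J, hJ, hIJ, Q, G, hQ, hG, rfl⟩, hP, by ring⟩
    · exact Or.inr ⟨I, mem_erase.2 ⟨hII, hI⟩, J, hJ, hIJ, P, Q, G, hP, hQ, hG, rfl⟩
  obtain ⟨g, r, hgr, hg, hr⟩ := h'.split
  obtain ⟨κ, _, p, e, hκ, he, hrep⟩ :=
    exists_freeze_decomposition B (fun A hA => hA.multilinearOn) hg
  have hX : SumOf (SepTerm a b 𝓙 𝓘) (N + N) (α + r) := by
    refine SumOf.add ?_ (hr.mono (fun f hf => hf.mono Subset.rfl h𝓙𝓘) le_rfl)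
    rw [← hs]
    obtain ⟨ι, _, t, hc, ht, rfl⟩ := h
    rw [swapVars_sum]
    exact ⟨ι, _, _, hc, fun i => (ht i).swapVars (fun I hI => (hab I hI).1)
      fun I hI => (hab I (h𝓙𝓘 hI)).2, rfl⟩
  have hgX : g = α + r := by rw [hgr, add_assoc, add_self_zmod_two, add_zero]
  rw [hgr]
  refine SumOf.add ?_ hr
  rw [hrep]
  refine SumOf.sum hκ fun t => ?_
  obtain ⟨ι, _, A, hι, hA, h⟩ := he t
  rw [h, sum_mul]
  refine SumOf.sum hι fun i => ?_
  rw [hgX]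
  exact (hX.map (mulFreeze B (p t) (A i)) (M := 1) fun f hf =>
    SumOf.single ((hA i).mulFreeze h𝓘 hf (p t))).mono (fun _ h => h) (mul_one _).le

end Reduction

section Diagonal

variable {V : Type*} [AddCommGroup V] [Module (ZMod 2) V] {k : ℕ} {N : ℕ}

/-- A product of two multilinear forms in complementary nonempty sets of variables. -/
def FactorTerm (f : (Fin k → V) → ZMod 2) : Prop :=
  ∃ I : Finset (Fin k), I ≠ ∅ ∧ I ≠ univ ∧ ∃ β γ : (Fin k → V) → ZMod 2,
    MultilinearOn k I β ∧ MultilinearOn k Iᶜ γ ∧ f = β * γ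

theorem PrankDecompOn.sumOf {f : (Fin k → V) → ZMod 2} (h : PrankDecompOn k univ N f) :
    SumOf FactorTerm N f := by
  obtain ⟨I, β, γ, -, h1, h2, hβ, hγ, h⟩ := h
  refine ⟨Fin N, inferInstance, fun i => β i * γ i, by simp,
    fun i => ⟨I i, h1 i, h2 i, β i, γ i, hβ i, hγ i, rfl⟩, funext fun x => ?_⟩
  simp [h x]

theorem SumOf.exists_prankDecompOn {f : (Fin k → V) → ZMod 2} (h : SumOf FactorTerm N f) :
    ∃ m ≤ N, PrankDecompOn k univ m f := by
  obtain ⟨ι, _, t, hc, ht, rfl⟩ := h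
  choose I h1 h2 β γ hβ hγ h using ht
  refine ⟨_, hc, ?_⟩
  let e := (Fintype.equivFin ι).symm
  refine ⟨fun i => I (e i), fun i => β (e i), fun i => γ (e i), fun i => subset_univ _,
    fun i => h1 _, fun i => h2 _, fun i => hβ _, fun i => hγ _, fun x => ?_⟩
  rw [Finset.sum_apply, ← e.sum_comp]
  exact sum_congr rfl fun i _ => by rw [h, Pi.mul_apply]

theorem SumOf.prank_le {f : (Fin k → V) → ZMod 2} (h : SumOf FactorTerm N f) : prank k f ≤ N := by
  obtain ⟨m, hm, h⟩ := h.exists_prankDecompOn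
  exact (Nat.sInf_le h).trans hm

theorem SumOf.prank {f : (Fin k → V) → ZMod 2} (h : SumOf FactorTerm N f) :
    SumOf FactorTerm (prank k f) f := by
  obtain ⟨m, -, h⟩ := h.exists_prankDecompOn
  exact PrankDecompOn.sumOf (Nat.sInf_mem (s := {m | PrankDecompOn k univ m f}) ⟨m, h⟩)

theorem prank_one (f : (Fin 1 → V) → ZMod 2) : prank 1 f = 0 := by
  by_contra h
  obtain ⟨I, β, γ, -, h0, h1, -⟩ : PrankDecompOn 1 univ (prank 1 f) f :=
    Nat.sInf_mem (Nat.nonempty_of_pos_sInf (Nat.pos_of_ne_zero h))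
  exact h1 ⟨0, Nat.pos_of_ne_zero h⟩ (nonempty_iff_ne_empty.2 (h0 _)).eq_univ

theorem sumOf_prank (hk : 2 ≤ k) {n : ℕ} {f : (Fin k → Fin n → ZMod 2) → ZMod 2}
    (hf : IsMultilinear k f) : SumOf FactorTerm (prank k f) f := by
  refine (PrankDecompOn.sumOf (N := n) ?_).prank
  let a : Fin k := ⟨0, by omega⟩
  refine ⟨fun _ => {a}, fun j x => x a j, fun j x => f (Function.update x a (Pi.single j 1)),
    fun _ => subset_univ _, fun _ => singleton_ne_empty _, fun _ h => ?_, fun j => ⟨?_, ?_⟩,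
    fun j => ⟨?_, ?_⟩, fun x => ?_⟩
  · have hb := mem_singleton.1 (Eq.mpr (congrArg (_ ∈ ·) h) (mem_univ (⟨1, hk⟩ : Fin k)))
    simp [a] at hb
  · intro x y hxy
    exact congrFun (hxy a (mem_singleton_self a)) j
  · intro i hi x u v
    rw [mem_singleton.1 hi]
    simp
  · intro x y hxy
    refine congrArg f (funext fun i => ?_)
    rcases eq_or_ne i a with rfl | hi
    · simp
    · simpa [hi] using hxy i (by simpa using hi)
  · intro i hi x u v
    have hi : i ≠ a := by simpa using hi
    simp only [Function.update_comm hi]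
    exact hf.2 i (mem_univ i) _ u v
  · let g : (Fin n → ZMod 2) →+ ZMod 2 :=
      AddMonoidHom.mk' (fun u => f (Function.update x a u)) (hf.2 a (mem_univ a) x)
    have h := map_sum g (fun j => Pi.single j (x a j)) univ
    rw [univ_sum_single] at h
    have h1 : g (x a) = f x := by simp [g]
    rw [← h1, h]
    refine sum_congr rfl fun j _ => ?_
    have : ∀ z : ZMod 2, g (Pi.single j z) = z * g (Pi.single j 1) := fun z => by
      have : ∀ z : ZMod 2, z = 0 ∨ z = 1 := by decide
      rcases this z with rfl | rfl <;> simp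
    exact this _

/-- The first variable. -/
def firstVar (hk : 2 ≤ k) : Fin k := ⟨0, by omega⟩

/-- The second variable. -/
def secondVar (hk : 2 ≤ k) : Fin k := ⟨1, by omega⟩

theorem firstVar_ne_secondVar (hk : 2 ≤ k) : firstVar hk ≠ secondVar hk := by
  simp [firstVar, secondVar]

theorem eq_firstVar_or_eq_secondVar_iff (hk : 2 ≤ k) {j : Fin k} :
    j = firstVar hk ∨ j = secondVar hk ↔ (j : ℕ) < 2 := by
  simp only [firstVar, secondVar, Fin.ext_iff]
  omega

theorem val_sub_one_lt (hk : 2 ≤ k) (j : Fin k) : (j : ℕ) - 1 < k - 1 := by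
  have := j.isLt
  omega

/-- Identify the first two of the variables. -/
def collapse (hk : 2 ≤ k) (j : Fin k) : Fin (k - 1) :=
  ⟨(j : ℕ) - 1, val_sub_one_lt hk j⟩

/-- The restriction of a function to the diagonal of its first two variables. -/
def diag (hk : 2 ≤ k) : ((Fin k → V) → ZMod 2) →+ ((Fin (k - 1) → V) → ZMod 2) where
  toFun f y := f fun j => y (collapse hk j)
  map_zero' := rfl
  map_add' _ _ := rfl

variable {hk : 2 ≤ k}

theorem collapse_eq_iff {i j : Fin k} : collapse hk i = collapse hk j ↔
    i = j ∨ (i : ℕ) < 2 ∧ (j : ℕ) < 2 := by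
  simp only [collapse, Fin.ext_iff]
  omega

theorem MultilinearOn.diag {S : Finset (Fin k)} {β : (Fin k → V) → ZMod 2}
    (h : MultilinearOn k S β) (hs : _root_.swapVars (firstVar hk) (secondVar hk) β = β)
    (hS : firstVar hk ∈ S ↔ secondVar hk ∈ S) :
    MultilinearOn (k - 1) (S.image (collapse hk)) (diag hk β) := by
  refine ⟨fun x y hxy => h.1 _ _ fun i hi => hxy _ (mem_image_of_mem _ hi), fun i hi y u v => ?_⟩
  obtain ⟨j, hj, rfl⟩ := mem_image.1 hi
  simp only [_root_.diag, AddMonoidHom.coe_mk, ZeroHom.coe_mk]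
  by_cases hj2 : (j : ℕ) < 2
  · have hab := firstVar_ne_secondVar hk
    have hlt := fun i : Fin k => eq_firstVar_or_eq_secondVar_iff hk (j := i)
    set a := firstVar hk
    set b := secondVar hk
    have hj' := (hlt j).2 hj2
    have haS : a ∈ S := by
      rcases hj' with rfl | rfl
      · exact hj
      · exact hS.2 hj
    have hbS : b ∈ S := hS.1 haS
    set z : Fin k → V := fun j => y (collapse hk j)
    have key : ∀ w, (fun i => Function.update y (collapse hk j) w (collapse hk i)) =
        Function.update (Function.update z a w) b w := fun w => by
      funext i
      by_cases hi2 : (i : ℕ) < 2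
      · have hi' := (hlt i).2 hi2
        have : collapse hk i = collapse hk j := collapse_eq_iff.2 (Or.inr ⟨hi2, hj2⟩)
        rcases hi' with rfl | rfl
        · simp [this, hab]
        · simp [this]
      · have h1 : i ≠ a := fun h => hi2 ((hlt i).1 (Or.inl h))
        have h2 : i ≠ b := fun h => hi2 ((hlt i).1 (Or.inr h))
        have h3 : collapse hk i ≠ collapse hk j := fun e => by
          rcases collapse_eq_iff.1 e with rfl | e
          · exact hi2 hj2
          · exact hi2 e.1
        simp [h1, h2, h3, z]
    have hsym : β (Function.update (Function.update z a u) b v) =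
        β (Function.update (Function.update z a v) b u) := by
      conv_lhs => rw [← hs]
      refine congrArg β (funext fun i => ?_)
      rcases eq_or_ne i a with rfl | h1
      · simp [hab]
      rcases eq_or_ne i b with rfl | h2
      · simp [hab]
      · simp [Equiv.swap_apply_of_ne_of_ne h1 h2, h1, h2]
    simp only [key]
    rw [h.2 b hbS]
    simp only [Function.update_comm hab] at hsym ⊢
    rw [h.2 a haS, h.2 a haS, hsym]
    have : ∀ p q r : ZMod 2, p + q + (q + r) = p + r := by decide
    exact this _ _ _
  · have key : ∀ w, (fun i => Function.update y (collapse hk j) w (collapse hk i)) =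
        Function.update (fun j => y (collapse hk j)) j w := fun w => by
      funext i
      rcases eq_or_ne i j with rfl | hij
      · simp
      · have h3 : collapse hk i ≠ collapse hk j := fun e => by
          rcases collapse_eq_iff.1 e with e | e
          · exact hij e
          · exact hj2 e.2
        simp [h3, hij]
    simp only [key]
    exact h.2 j hj _ u v

theorem GoodTerm.diag {f : (Fin k → V) → ZMod 2}
    (hf : GoodTerm (firstVar hk) (secondVar hk) f) : FactorTerm (diag hk f) := by
  obtain ⟨J, S, G, hJ, ha, hb, hS, hs, hG, rfl⟩ := hf
  have hco : (Jᶜ.image (collapse hk))ᶜ = J.image (collapse hk) := by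
    ext i
    simp only [mem_compl, mem_image, not_exists, not_and]
    constructor
    · intro h
      by_contra! h'
      have hi : collapse hk ⟨i + 1, by omega⟩ = i := by simp [collapse]
      exact h' _ (by_contra fun hj => h _ hj hi) hi
    · rintro ⟨j, hj, rfl⟩ i hi e
      rcases collapse_eq_iff.1 e with rfl | ⟨-, e⟩
      · exact hi hj
      · rcases (eq_firstVar_or_eq_secondVar_iff hk).2 e with rfl | rfl
        · exact ha hj
        · exact hb hj
  refine ⟨Jᶜ.image (collapse hk), (image_nonempty.2 ⟨_, mem_compl.2 ha⟩).ne_empty, fun h => ?_,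
    _root_.diag hk S, _root_.diag hk G, hS.diag hs (by simp [ha, hb]), ?_, rfl⟩
  · rw [h, compl_univ] at hco
    exact (hJ.image _).ne_empty hco.symm
  · rw [hco]
    exact hG.diag (hG.swapVars_eq ha hb) (by simp [ha, hb])

omit [AddCommGroup V] [Module (ZMod 2) V] in
theorem diag_swapVars (f : (Fin k → V) → ZMod 2) :
    diag hk (swapVars (firstVar hk) (secondVar hk) f) = diag hk f := by
  funext y
  refine congrArg f (funext fun i => congrArg y ?_)
  rcases eq_or_ne i (firstVar hk) with rfl | h1
  · simp [collapse, firstVar, secondVar]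
  rcases eq_or_ne i (secondVar hk) with rfl | h2
  · simp [collapse, firstVar, secondVar]
  · rw [Equiv.swap_apply_of_ne_of_ne h1 h2]

end Diagonal

section Bound

variable {k : ℕ}

/-- The restriction to the diagonal of a symmetric sum of terms of the given kinds is a sum of
polynomially many products. -/
def DiagBound (hk : 2 ≤ k) (𝓘 𝓙 : Finset (Finset (Fin k))) : Prop :=
  ∃ c : ℕ, ∀ (n N : ℕ) (α : (Fin k → Fin n → ZMod 2) → ZMod 2), IsMultilinear k α →
    swapVars (firstVar hk) (secondVar hk) α = α →
    SumOf (fun f => SameTerm (firstVar hk) (secondVar hk) 𝓘 f ∨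
      SepTerm (firstVar hk) (secondVar hk) 𝓙 𝓙 f) N α →
    SumOf FactorTerm ((N + 2) ^ c) (diag hk α)

variable {hk : 2 ≤ k}

theorem diagBound_empty : DiagBound hk ∅ ∅ := by
  refine ⟨0, fun n N α _ _ h => ?_⟩
  obtain ⟨ι, _, t, -, ht, rfl⟩ := h
  have : IsEmpty ι := ⟨fun i => by
    rcases ht i with ⟨I, hI, -⟩ | ⟨I, hI, -⟩ <;> exact notMem_empty I hI⟩
  rw [Fintype.sum_empty, map_zero]
  exact SumOf.zero

theorem DiagBound.of_erase_same {𝓘 𝓙 : Finset (Finset (Fin k))} {I₀ : Finset (Fin k)}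
    (h : DiagBound hk (𝓘.erase I₀) 𝓙) (h𝓙 : ∀ I ∈ 𝓙, ∀ J ⊆ I, J ∈ 𝓙)
    (h𝓘 : ∀ I ∈ 𝓘.erase I₀, ∀ J ⊆ I, J ∈ 𝓘.erase I₀)
    (hI₀ : insert (firstVar hk) (insert (secondVar hk) I₀) ≠ univ) : DiagBound hk 𝓘 𝓙 := by
  obtain ⟨c, hc⟩ := h
  refine ⟨2 * c + 2, fun n N α hα hs h => ?_⟩
  obtain ⟨G, α', rfl, hG, hα'⟩ := exists_reduction_same h𝓙 h𝓘 hI₀ hα hs h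
  have hGα : α' = G + α' + G := by rw [add_right_comm, add_self_zmod_two, zero_add]
  have hML : IsMultilinear k α' := by
    rw [hGα]
    exact hα.add (hG.isMultilinear fun _ h => h.isMultilinear)
  have hsym : swapVars (firstVar hk) (secondVar hk) α' = α' := by
    conv_rhs => rw [hGα]
    conv_lhs => rw [hGα]
    rw [swapVars_add, hs, hG.swapVars_eq]
  rw [map_add]
  refine ((hG.map (diag hk) (M := 1) fun f hf => SumOf.single hf.diag).add
    (hc n _ α' hML hsym hα')).mono (fun _ h => h) ?_
  have h1 : N * N + N + 2 ≤ (N + 2) ^ 2 := by nlinarith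
  have h2 : (N * N + N + 2) ^ c ≤ (N + 2) ^ (2 * c) := by
    rw [pow_mul]
    exact Nat.pow_le_pow_left h1 c
  have h3 : 1 ≤ (N + 2) ^ (2 * c) := Nat.one_le_pow _ _ (by omega)
  rw [pow_add]
  nlinarith

theorem DiagBound.of_erase_sep {𝓙 : Finset (Finset (Fin k))} {I₀ : Finset (Fin k)}
    (h : DiagBound hk ∅ (𝓙.erase I₀))
    (h𝓙 : ∀ I ∈ 𝓙.erase I₀, ∀ J ⊆ I, J ∈ 𝓙.erase I₀)
    (hab : ∀ I ∈ 𝓙, firstVar hk ∉ I ∧ secondVar hk ∉ I)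
    (hI₀ : I₀.Nonempty) : DiagBound hk ∅ 𝓙 := by
  obtain ⟨c, hc⟩ := h
  refine ⟨7 * c, fun n N α hα hs h => ?_⟩
  obtain ⟨g, hg⟩ := exists_orientation hab hI₀
    (h.mono (fun f hf => hf.resolve_left fun ⟨I, hI, _⟩ => notMem_empty I hI) le_rfl)
  set a := firstVar hk
  set b := secondVar hk
  have hsym : swapVars a b (α + (g + swapVars a b g)) = α + (g + swapVars a b g) := by
    rw [swapVars_add, swapVars_add, swapVars_swapVars, hs, add_comm g]
  have hdiag : diag hk α = diag hk (α + (g + swapVars a b g)) := by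
    rw [map_add, map_add, diag_swapVars, add_self_zmod_two, add_zero]
  rw [hdiag]
  refine (hc n _ _ (hg.isMultilinear fun _ h => h.isMultilinear) hsym
    ((sumOf_sepTerm_erase hab h𝓙 hsym hg).mono (fun _ h => Or.inr h) le_rfl)).mono
    (fun _ h => h) ?_
  rw [pow_mul]
  refine Nat.pow_le_pow_left ?_ c
  have h1 : 2 ^ 4 ≤ (N + 2) ^ 4 := Nat.pow_le_pow_left (by omega) 4
  calc _ ≤ 2 ^ 4 * (N + 2) ^ 3 := by ring_nf; nlinarith
    _ ≤ (N + 2) ^ 4 * (N + 2) ^ 3 := Nat.mul_le_mul_right _ h1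
    _ = (N + 2) ^ 7 := by ring

theorem DiagBound.mono {𝓘 𝓙 𝓘' 𝓙' : Finset (Finset (Fin k))} (h : DiagBound hk 𝓘' 𝓙')
    (hf : ∀ (n : ℕ) (f : (Fin k → Fin n → ZMod 2) → ZMod 2),
      SameTerm (firstVar hk) (secondVar hk) 𝓘 f ∨ SepTerm (firstVar hk) (secondVar hk) 𝓙 𝓙 f →
      SameTerm (firstVar hk) (secondVar hk) 𝓘' f ∨ SepTerm (firstVar hk) (secondVar hk) 𝓙' 𝓙' f) :
    DiagBound hk 𝓘 𝓙 := by
  obtain ⟨c, hc⟩ := h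
  exact ⟨c, fun n N α hα hs h => hc n N α hα hs (h.mono (hf n) le_rfl)⟩

theorem lower_family_induction {ι : Type*} [DecidableEq ι] {P : Finset (Finset ι) → Prop}
    (h0 : P ∅)
    (step : ∀ (𝓘 : Finset (Finset ι)) (I₀ : Finset ι), I₀ ∈ 𝓘 →
      (∀ I ∈ 𝓘.erase I₀, ∀ J ⊆ I, J ∈ 𝓘.erase I₀) → P (𝓘.erase I₀) → P 𝓘)
    (𝓘 : Finset (Finset ι)) (h𝓘 : ∀ I ∈ 𝓘, ∀ J ⊆ I, J ∈ 𝓘) : P 𝓘 := by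
  induction 𝓘 using Finset.strongInduction with
  | H 𝓘 ih =>
    rcases 𝓘.eq_empty_or_nonempty with rfl | hne
    · exact h0
    obtain ⟨I₀, hI₀⟩ := 𝓘.exists_maximal hne
    have hlow : ∀ I ∈ 𝓘.erase I₀, ∀ J ⊆ I, J ∈ 𝓘.erase I₀ := fun I hI J hJ => by
      have hI' := mem_erase.1 hI
      refine mem_erase.2 ⟨?_, h𝓘 I hI'.2 J hJ⟩
      rintro rfl
      exact hI'.1 (Subset.antisymm (hI₀.2 hI'.2 hJ) hJ)
    exact step 𝓘 I₀ hI₀.1 hlow (ih _ (erase_ssubset hI₀.1) hlow)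

theorem diagBound_sep (h3 : 3 ≤ k) (𝓙 : Finset (Finset (Fin k)))
    (h𝓙 : ∀ I ∈ 𝓙, ∀ J ⊆ I, J ∈ 𝓙)
    (hab : ∀ I ∈ 𝓙, firstVar hk ∉ I ∧ secondVar hk ∉ I) :
    DiagBound hk ∅ 𝓙 := by
  revert hab
  refine lower_family_induction (P := fun 𝓙 => (∀ I ∈ 𝓙, firstVar hk ∉ I ∧ secondVar hk ∉ I) →
    DiagBound hk ∅ 𝓙) (fun _ => diagBound_empty) (fun 𝓘 I₀ hI₀ hlow ih hab => ?_) 𝓙 h𝓙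
  rcases I₀.eq_empty_or_nonempty with rfl | hne
  · have h𝓘 : ∀ I ∈ 𝓘, I = ∅ := fun I hI => by
      by_contra hne
      exact notMem_erase ∅ 𝓘 (hlow I (mem_erase.2 ⟨hne, hI⟩) ∅ (empty_subset I))
    have hbase : DiagBound hk {∅} ∅ := by
      refine DiagBound.of_erase_same (I₀ := ∅) ?_ (by simp) (by simp) fun h => ?_
      · rw [show ({∅} : Finset (Finset (Fin k))).erase ∅ = ∅ by simp]
        exact diagBound_empty
      · have := h ▸ mem_univ (⟨2, h3⟩ : Fin k)
        simp [firstVar, secondVar] at this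
    refine hbase.mono fun n f hf => Or.inl ?_
    obtain ⟨I, hI, J, hJ, hIJ, P, Q, G, hP, hQ, hG, rfl⟩ :=
      hf.resolve_left fun ⟨I, hI, _⟩ => notMem_empty I hI
    obtain rfl := h𝓘 I hI
    obtain rfl := h𝓘 J hJ
    exact ⟨∅, mem_singleton_self _, P * Q, G, hP.mul hIJ hQ, hG, rfl⟩
  · exact (ih fun I hI => hab I (mem_of_mem_erase hI)).of_erase_sep hlow hab hne

theorem diagBound_of_lower (h3 : 3 ≤ k) {𝓘 𝓙 : Finset (Finset (Fin k))}
    (h𝓘 : ∀ I ∈ 𝓘, ∀ J ⊆ I, J ∈ 𝓘) (h𝓙 : ∀ I ∈ 𝓙, ∀ J ⊆ I, J ∈ 𝓙)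
    (hab : ∀ I ∈ 𝓙, firstVar hk ∉ I ∧ secondVar hk ∉ I)
    (hne : ∀ I ∈ 𝓘, insert (firstVar hk) (insert (secondVar hk) I) ≠ univ) :
    DiagBound hk 𝓘 𝓙 := by
  revert hne
  exact lower_family_induction (P := fun 𝓘 => (∀ I ∈ 𝓘, insert (firstVar hk)
    (insert (secondVar hk) I) ≠ univ) → DiagBound hk 𝓘 𝓙) (fun _ => diagBound_sep h3 𝓙 h𝓙 hab)
    (fun 𝓘 I₀ hI₀ hlow ih hne => (ih fun I hI => hne I (mem_of_mem_erase hI)).of_erase_same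
      h𝓙 hlow (hne I₀ hI₀)) 𝓘 h𝓘

theorem FactorTerm.sameTerm_or_sepTerm {V : Type*} [AddCommGroup V] [Module (ZMod 2) V]
    {a b : Fin k} {f : (Fin k → V) → ZMod 2} (hf : FactorTerm f) :
    SameTerm a b {I | insert a (insert b I) ≠ univ} f ∨
      SepTerm a b {I | a ∉ I ∧ b ∉ I} {I | a ∉ I ∧ b ∉ I} f := by
  obtain ⟨I, h0, h1, β, γ, hβ, hγ, rfl⟩ := hf
  wlog ha : a ∈ I generalizing I β γ
  · rw [mul_comm]
    exact this Iᶜ (by simpa) (by simpa) γ β hγ (by rwa [compl_compl]) (mem_compl.2 ha)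
  by_cases hb : b ∈ I
  · refine Or.inl ⟨I, ?_, β, γ, ?_⟩ <;> simp [ha, hb, h1, hβ, hγ]
  · have hab : b ≠ a := by rintro rfl; exact hb ha
    have hbc : b ∈ Iᶜ := mem_compl.2 hb
    refine Or.inr ⟨I.erase a, by simp [hb], Iᶜ.erase b, by simp [ha], ?_, β, γ, 1, ?_, ?_, ?_,
      (mul_one _).symm⟩
    · rw [insert_erase ha, insert_erase hbc]
      exact disjoint_compl_right
    · rwa [insert_erase ha]
    · rwa [insert_erase hbc]
    · rw [insert_erase ha, insert_erase hbc, union_compl, compl_univ]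
      exact multilinearOn_one

/-- Restricting a symmetric form to the diagonal increases its partition rank at most
polynomially. -/
theorem exists_prank_diag_le (h3 : 3 ≤ k) : ∃ c : ℕ, 1 ≤ c ∧
    ∀ (n : ℕ) (α : (Fin k → Fin n → ZMod 2) → ZMod 2), IsMultilinear k α →
      swapVars (firstVar hk) (secondVar hk) α = α →
      SumOf FactorTerm ((prank k α + 2) ^ c) (diag hk α) := by
  have hbound : DiagBound hk {I | insert (firstVar hk) (insert (secondVar hk) I) ≠ univ}
      {I | firstVar hk ∉ I ∧ secondVar hk ∉ I} := by
    refine diagBound_of_lower h3 (fun I hI J hJ => ?_) (fun I hI J hJ => ?_) (by simp) (by simp)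
    · simp only [mem_filter, mem_univ, true_and] at hI ⊢
      exact fun h => hI (univ_subset_iff.1
        (h ▸ insert_subset_insert _ (insert_subset_insert _ hJ)))
    · simp only [mem_filter, mem_univ, true_and] at hI ⊢
      exact ⟨fun h => hI.1 (hJ h), fun h => hI.2 (hJ h)⟩
  obtain ⟨c, hc⟩ := hbound
  exact ⟨c + 1, by omega, fun n α hα hs => (hc n _ α hα hs ((sumOf_prank hk hα).mono
    (fun f hf => hf.sameTerm_or_sepTerm) le_rfl)).mono (fun _ h => h)
    (Nat.pow_le_pow_right (by omega) (by omega))⟩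

end Bound

section Regularization

theorem le_of_mem_sup_span {W : Type*} [AddCommGroup W] [Module (ZMod 2) W] {p : W → ℕ}
    (hp : ∀ x y, p (x + y) ≤ p x + p y) {U : Submodule (ZMod 2) W} {R R' : ℕ}
    (hU : ∀ x ∈ U, p x ≤ R) {v : W} (hv : R + p v ≤ R') :
    ∀ x ∈ U ⊔ Submodule.span (ZMod 2) {v}, p x ≤ R' := by
  intro x hx
  obtain ⟨y, hy, z, hz, rfl⟩ := Submodule.mem_sup.1 hx
  obtain ⟨t, rfl⟩ := Submodule.mem_span_singleton.1 hz
  have hy := hU y hy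
  have : ∀ z : ZMod 2, z = 0 ∨ z = 1 := by decide
  rcases this t with rfl | rfl
  · rw [zero_smul, add_zero]
    omega
  · rw [one_smul]
    exact (hp y v).trans (by omega)

theorem lt_sup_span {W : Type*} [AddCommGroup W] [Module (ZMod 2) W]
    {U : Submodule (ZMod 2) W} {v : W} (hv : v ∉ U) : U < U ⊔ Submodule.span (ZMod 2) {v} :=
  lt_of_le_of_ne le_sup_left fun h =>
    hv (h ▸ (le_sup_right (a := U) (Submodule.mem_span_singleton_self v)))

theorem add_rpow_add_two_pow_le {X₀ M e : ℝ} {R c : ℕ} (hX₀ : 3 ≤ X₀) (hM : 1 ≤ M) (he : 1 ≤ e)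
    (hR1 : 1 ≤ (R : ℝ)) (hR : (R : ℝ) ≤ X₀ ^ e) (hc : 1 ≤ c) :
    R + ((2 * (R : ℝ) + 1) ^ M + 2) ^ c ≤ X₀ ^ (e * (2 * (2 * c + 1) * M)) := by
  set X : ℝ := 2 * R + 1 with hX
  have hX3 : 3 ≤ X := by linarith
  set y : ℝ := X ^ M
  have hXy : X ≤ y := Real.self_le_rpow_of_one_le (by linarith) hM
  have hy3 : 3 ≤ y := hX3.trans hXy
  have h1 : (y + 2) ^ c ≤ y ^ (2 * c) := by
    rw [pow_mul]
    exact pow_le_pow_left₀ (by linarith) (by nlinarith) c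
  have h2 : y ≤ y ^ (2 * c) := le_self_pow₀ (by linarith) (by omega)
  have h3 : R + (y + 2) ^ c ≤ y ^ (2 * c + 1) := by
    rw [pow_succ]
    nlinarith
  have hX₀e : 3 ≤ X₀ ^ e := hX₀.trans (Real.self_le_rpow_of_one_le (by linarith) he)
  have h4 : X ≤ X₀ ^ (e * 2) := by
    rw [Real.rpow_mul (by linarith), Real.rpow_two]
    nlinarith
  calc _ ≤ y ^ (2 * c + 1) := h3
    _ = X ^ (M * (2 * c + 1)) := by
      rw [Real.rpow_mul (by linarith), ← Real.rpow_natCast]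
      push_cast
      rfl
    _ ≤ (X₀ ^ (e * 2)) ^ (M * (2 * c + 1)) :=
      Real.rpow_le_rpow (by linarith) h4 (by positivity)
    _ = X₀ ^ (e * (2 * (2 * c + 1) * M)) := by
      rw [← Real.rpow_mul (by linarith)]
      ring_nf

/-- Two subadditive functions on `𝔽₂^r`, the second of which is bounded polynomially in terms of
the first, are small on nested subspaces outside of which they are large. -/
theorem exists_regularization {r : ℕ} {p q : (Fin r → ZMod 2) → ℕ} (hp0 : p 0 = 0) (hq0 : q 0 = 0)
    (hp : ∀ x y, p (x + y) ≤ p x + p y) (hq : ∀ x y, q (x + y) ≤ q x + q y) {c : ℕ} (hc : 1 ≤ c)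
    (hpq : ∀ x, q x ≤ (p x + 2) ^ c) {M R₀ : ℝ} (hM : 1 ≤ M) (hR₀ : 1 ≤ R₀) :
    ∃ R : ℕ, R₀ ≤ R ∧ (R : ℝ) ≤ (2 * R₀ + 1) ^ ((2 * (2 * c + 1) * M) ^ (2 * (r : ℝ))) ∧
      ∃ U U' : Submodule (ZMod 2) (Fin r → ZMod 2), U ≤ U' ∧
        (∀ x, (x ∈ U → p x ≤ R) ∧ (x ∉ U → (2 * (R : ℝ) + 1) ^ M ≤ p x)) ∧
        ∀ x, (x ∈ U' → q x ≤ R) ∧ (x ∉ U' → (2 * (R : ℝ) + 1) ^ M ≤ q x) := by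
  set E : ℝ := 2 * (2 * c + 1) * M with hE
  have hE1 : 1 ≤ E := by
    have : (0 : ℝ) ≤ c := c.cast_nonneg
    nlinarith
  suffices h : ∀ (d j R : ℕ) (U U' : Submodule (ZMod 2) (Fin r → ZMod 2)), j + d = 2 * r + 1 →
      j ≤ Module.finrank (ZMod 2) U + Module.finrank (ZMod 2) U' → U ≤ U' → R₀ ≤ R →
      (R : ℝ) ≤ (2 * R₀ + 1) ^ (E ^ j) → (∀ x ∈ U, p x ≤ R) → (∀ x ∈ U', q x ≤ R) →
      ∃ R : ℕ, R₀ ≤ R ∧ (R : ℝ) ≤ (2 * R₀ + 1) ^ (E ^ (2 * (r : ℝ))) ∧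
        ∃ U U' : Submodule (ZMod 2) (Fin r → ZMod 2), U ≤ U' ∧
          (∀ x, (x ∈ U → p x ≤ R) ∧ (x ∉ U → (2 * (R : ℝ) + 1) ^ M ≤ p x)) ∧
          ∀ x, (x ∈ U' → q x ≤ R) ∧ (x ∉ U' → (2 * (R : ℝ) + 1) ^ M ≤ q x) by
    refine h (2 * r + 1) 0 ⌈R₀⌉₊ ⊥ ⊥ (by omega) (by simp) le_rfl (Nat.le_ceil _) ?_ ?_ ?_
    · have := (Nat.ceil_lt_add_one (zero_le_one.trans hR₀)).le
      rw [pow_zero, Real.rpow_one]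
      linarith
    · rintro x rfl
      simp [hp0]
    · rintro x rfl
      simp [hq0]
  have hfin : ∀ U : Submodule (ZMod 2) (Fin r → ZMod 2), Module.finrank (ZMod 2) U ≤ r :=
    fun U => by simpa using U.finrank_le
  intro d
  induction d with
  | zero =>
    intro j R U U' hj hdim
    have := hfin U
    have := hfin U'
    omega
  | succ d ih =>
    intro j R U U' hj hdim hUU' hR₀R hR hU hU'
    set R' := ⌊R + ((2 * (R : ℝ) + 1) ^ M + 2) ^ c⌋₊ with hR'
    have hR1 : 1 ≤ (R : ℝ) := hR₀.trans hR₀R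
    have hpow : 0 ≤ (2 * (R : ℝ) + 1) ^ M := by positivity
    have hle : ∀ t : ℕ, (t : ℝ) ≤ ((2 * (R : ℝ) + 1) ^ M + 2) ^ c → R + t ≤ R' := fun t ht => by
      refine Nat.le_floor ?_
      push_cast
      linarith
    have hRR' : R₀ ≤ R' := hR₀R.trans (by
      exact_mod_cast (Nat.le_add_right R 0).trans (hle 0 (by rw [Nat.cast_zero]; positivity)))
    have hR'le : (R' : ℝ) ≤ (2 * R₀ + 1) ^ (E ^ (j + 1)) := by
      rw [pow_succ]
      exact (Nat.floor_le (by positivity)).trans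
        (add_rpow_add_two_pow_le (by linarith) hM (one_le_pow₀ hE1) hR1 hR hc)
    have hlt : ∀ t : ℕ, (t : ℝ) < (2 * (R : ℝ) + 1) ^ M →
        (t : ℝ) ≤ ((2 * (R : ℝ) + 1) ^ M + 2) ^ c := fun t ht =>
      (by linarith : (t : ℝ) ≤ (2 * (R : ℝ) + 1) ^ M + 2).trans
        (le_self_pow₀ (by linarith) (by omega))
    by_cases h1 : ∃ v ∉ U, (p v : ℝ) < (2 * (R : ℝ) + 1) ^ M
    · obtain ⟨v, hvU, hv⟩ := h1
      have hd1 := Submodule.finrank_lt_finrank_of_lt (lt_sup_span hvU)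
      have hd2 := Submodule.finrank_mono (le_sup_left : U' ≤ U' ⊔ Submodule.span (ZMod 2) {v})
      refine ih (j + 1) R' _ _ (by omega) (by omega)
        (sup_le_sup_right hUU' (Submodule.span (ZMod 2) {v})) hRR' hR'le
        (le_of_mem_sup_span hp hU (hle _ (hlt _ hv)))
        (le_of_mem_sup_span hq hU' (hle _ ?_))
      calc (q v : ℝ) ≤ ((p v : ℝ) + 2) ^ c := by exact_mod_cast hpq v
        _ ≤ _ := pow_le_pow_left₀ (by positivity) (by linarith) c
    by_cases h2 : ∃ v ∉ U', (q v : ℝ) < (2 * (R : ℝ) + 1) ^ M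
    · obtain ⟨v, hvU, hv⟩ := h2
      have hd1 := Submodule.finrank_lt_finrank_of_lt (lt_sup_span hvU)
      have hle0 := hle 0 (by rw [Nat.cast_zero]; positivity)
      exact ih (j + 1) R' U _ (by omega) (by omega) (hUU'.trans le_sup_left) hRR' hR'le
        (fun x hx => (hU x hx).trans (by omega))
        (le_of_mem_sup_span hq hU' (hle _ (hlt _ hv)))
    push Not at h1 h2
    refine ⟨R, hR₀R, hR.trans ?_, U, U', hUU', fun x => ⟨hU x, h1 x⟩, fun x => ⟨hU' x, h2 x⟩⟩
    refine Real.rpow_le_rpow_of_exponent_le (by linarith) ?_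
    rw [show 2 * (r : ℝ) = ((2 * r : ℕ) : ℝ) by push_cast; rfl, Real.rpow_natCast]
    exact pow_le_pow_right₀ hE1 (by omega)

end Regularization

/-- **Lemma 22 (regularization respecting the doubling operation).**
For every `k` there is a constant `c_k` such that: given multilinear forms
`α₁, …, α_r : G^k → 𝔽₂` symmetric in their first two variables and parameters
`M, R₀ ≥ 1`, there are `R₀ ≤ R ≤ (2R₀+1)^{(c_k M)^{2r}}` and subspaces
`Λ ≤ Λ^{×2} ≤ 𝔽₂^r` such that linear combinations `λ·α` with `λ ∈ Λ` (resp.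
`λ·α^{×2}` with `λ ∈ Λ^{×2}`) have partition rank at most `R`, while those with
`λ ∉ Λ` (resp. `λ ∉ Λ^{×2}`) have partition rank at least `(2R+1)^M`. -/
theorem statement16 (k : ℕ) (hk : 2 ≤ k) :
    ∃ c : ℝ, 1 ≤ c ∧
      ∀ (n r : ℕ) (α : Fin r → ((Fin k → (Fin n → ZMod 2)) → ZMod 2)),
        (∀ i, IsMultilinear k (α i)) → (∀ i, SymmetricInFirst k 2 (α i)) →
        ∀ M R₀ : ℝ, 1 ≤ M → 1 ≤ R₀ →
          ∃ R : ℕ, R₀ ≤ (R : ℝ) ∧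
            (R : ℝ) ≤ (2 * R₀ + 1) ^ ((c * M) ^ (2 * (r : ℝ))) ∧
            ∃ Lam Lam2 : Submodule (ZMod 2) (Fin r → ZMod 2), Lam ≤ Lam2 ∧
              (∀ lam : Fin r → ZMod 2,
                (lam ∈ Lam → prank k (fun x => ∑ i, lam i * α i x) ≤ R) ∧
                (lam ∉ Lam →
                  (2 * (R : ℝ) + 1) ^ M ≤
                    (prank k (fun x => ∑ i, lam i * α i x) : ℝ))) ∧
              (∀ lam : Fin r → ZMod 2,
                (lam ∈ Lam2 →
                  prank (k - 1) (fun y : Fin (k - 1) → Fin n → ZMod 2 =>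
                    ∑ i, lam i *
                      α i (fun j => y ⟨(j : ℕ) - 1, by have := j.isLt; omega⟩)) ≤ R) ∧
                (lam ∉ Lam2 →
                  (2 * (R : ℝ) + 1) ^ M ≤
                    (prank (k - 1) (fun y : Fin (k - 1) → Fin n → ZMod 2 =>
                      ∑ i, lam i *
                        α i (fun j => y ⟨(j : ℕ) - 1, by have := j.isLt; omega⟩)) : ℝ))) := by
  let F (n r : ℕ) (α : Fin r → (Fin k → Fin n → ZMod 2) → ZMod 2) :
      (Fin r → ZMod 2) →+ ((Fin k → Fin n → ZMod 2) → ZMod 2) :=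
    AddMonoidHom.mk' (fun lam x => ∑ i, lam i * α i x) fun lam mu => funext fun x => by
      simp [add_mul, sum_add_distrib]
  have hF : ∀ (n r : ℕ) (α : Fin r → (Fin k → Fin n → ZMod 2) → ZMod 2),
      (∀ i, IsMultilinear k (α i)) → ∀ lam, IsMultilinear k (F n r α lam) := by
    intro n r α hα lam
    have h : F n r α lam = ∑ i, lam i • α i := funext fun x => by simp [F, Finset.sum_apply]
    rw [h]
    refine MultilinearOn.sum fun i => ⟨fun x y hxy => ?_, fun j hj x u v => ?_⟩
    · simp [(hα i).1 x y hxy]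
    · simp [(hα i).2 j hj x u v, mul_add]
  have hFs : ∀ (n r : ℕ) (α : Fin r → (Fin k → Fin n → ZMod 2) → ZMod 2),
      (∀ i, SymmetricInFirst k 2 (α i)) → ∀ lam,
      swapVars (firstVar hk) (secondVar hk) (F n r α lam) = F n r α lam := by
    intro n r α hs lam
    funext x
    refine sum_congr rfl fun i (_ : i ∈ univ) => congrArg (lam i * ·) ?_
    exact congrFun (hs i (firstVar hk) (secondVar hk) (by simp [firstVar])
      (by simp [secondVar])) x
  have hprank : ∀ {n m : ℕ}, prank m (0 : (Fin m → Fin n → ZMod 2) → ZMod 2) = 0 := fun {n m} =>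
    Nat.le_zero.1 (SumOf.zero (P := FactorTerm) (N := 0)).prank_le
  obtain ⟨c, hc, hbound⟩ : ∃ c : ℕ, 1 ≤ c ∧
      ∀ (n r : ℕ) (α : Fin r → (Fin k → Fin n → ZMod 2) → ZMod 2),
        (∀ i, IsMultilinear k (α i)) → (∀ i, SymmetricInFirst k 2 (α i)) →
        (∀ lam, prank (k - 1) (diag hk (F n r α lam)) ≤ (prank k (F n r α lam) + 2) ^ c) ∧
        ∀ lam mu, prank (k - 1) (diag hk (F n r α (lam + mu))) ≤
          prank (k - 1) (diag hk (F n r α lam)) + prank (k - 1) (diag hk (F n r α mu)) := by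
    rcases hk.eq_or_lt with rfl | h3
    · refine ⟨1, le_rfl, fun n r α _ _ => ?_⟩
      simp [prank_one]
    · obtain ⟨c, hc, h⟩ := exists_prank_diag_le (hk := hk) h3
      have hdiag := fun n r α hα hs lam => h n _ (hF n r α hα lam) (hFs n r α hs lam)
      refine ⟨c, hc, fun n r α hα hs => ⟨fun lam => (hdiag n r α hα hs lam).prank_le,
        fun lam mu => ?_⟩⟩
      rw [map_add, map_add]
      exact ((hdiag n r α hα hs lam).prank.add (hdiag n r α hα hs mu).prank).prank_le
  refine ⟨2 * (2 * c + 1), by have : (0 : ℝ) ≤ c := c.cast_nonneg; linarith,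
    fun n r α hα hs M R₀ hM hR₀ => ?_⟩
  exact exists_regularization (p := fun lam => prank k (F n r α lam))
    (q := fun lam => prank (k - 1) (diag hk (F n r α lam)))
    (by simp [hprank]) (by simp [hprank])
    (fun lam mu => by
      rw [map_add]
      exact ((sumOf_prank hk (hF n r α hα lam)).add (sumOf_prank hk (hF n r α hα mu))).prank_le)
    (hbound n r α hα hs).2 hc (hbound n r α hα hs).1 hM hR₀
end

section
/- Suppose a function f : G → 𝔻 and a multilinear form α : G^k → 𝔽₂ satisfy |E_{x,a₁,…,a_k ∈ G} Δ×_{a₁}⋯Δ×_{a_k} f(x) · (−1)^{α(a₁,…,a_k)}| ≥ c. Let U ≤ G be any subspace. Then there exists a function f̃ : U → 𝔻 such that |E_{x,a₁,…,a_k ∈ U} Δ×_{a₁}⋯Δ×_{a_k} f̃(x) · (−1)^{α(a₁,…,a_k)}| ≥ c. -/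
open Finset

/-- The multiplicative derivative `Δ×_a f (x) = f(x+a) ⬝ conj (f x)`. -/
def mder {G : Type*} [AddCommGroup G] (f : G → ℂ) (a : G) : G → ℂ :=
  fun x => f (x + a) * (starRingEnd ℂ) (f x)

/-- The iterated multiplicative derivative `Δ×_{a₁} ⋯ Δ×_{a_k} f`. -/
def mderIter {G : Type*} [AddCommGroup G] : (k : ℕ) → (G → ℂ) → (Fin k → G) → G → ℂ
  | 0, f, _ => f
  | k + 1, f, a => mderIter k (mder f (a 0)) (fun i => a i.succ)

/-- `(-1)^e` for `e : 𝔽₂`. -/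
def chF2 (e : ZMod 2) : ℂ := (-1 : ℂ) ^ e.val

lemma mderIter_mder {G : Type*} [AddCommGroup G] (k : ℕ) (f : G → ℂ) (c : G) (a : Fin k → G) :
    mderIter k (mder f c) a = mder (mderIter k f a) c := by
  induction k generalizing f c with
  | zero => rfl
  | succ k ih =>
    simp only [mderIter, ih]
    funext x
    simp only [mder, map_mul, Complex.conj_conj, add_right_comm x c]
    ring

lemma mderIter_insertNth {G : Type*} [AddCommGroup G] (k : ℕ) (i : Fin (k + 1)) (f : G → ℂ)
    (c : G) (a : Fin k → G) :
    mderIter (k + 1) f (i.insertNth c a) = mder (mderIter k f a) c := by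
  induction k generalizing f with
  | zero =>
    obtain rfl : i = 0 := Fin.fin_one_eq_zero i
    rfl
  | succ k ih =>
    cases i using Fin.cases with
    | zero =>
      rw [mderIter, mderIter_mder]
      simp
    | succ i =>
      have h : (fun j : Fin (k + 1) => (i.succ.insertNth c a : Fin (k + 2) → G) j.succ)
          = i.insertNth c (fun j => a j.succ) := by
        funext j
        cases j using Fin.succAboveCases i with
        | x => simp
        | p j => rw [← Fin.succ_succAbove_succ, Fin.insertNth_apply_succAbove,
          Fin.insertNth_apply_succAbove]
      have h₀ : (i.succ.insertNth c a : Fin (k + 2) → G) 0 = a 0 := by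
        rw [← Fin.succ_succAbove_zero i, Fin.insertNth_apply_succAbove]
      rw [mderIter, h, ih, h₀]
      rfl

lemma mderIter_comp {G H : Type*} [AddCommGroup G] [AddCommGroup H] (φ : H → G) (ψ : H → G)
    (h : ∀ x a, φ (x + a) = φ x + ψ a) (k : ℕ) (f : G → ℂ) (a : Fin k → H) (x : H) :
    mderIter k (fun u => f (φ u)) a x = mderIter k f (fun i => ψ (a i)) (φ x) := by
  induction k generalizing f with
  | zero => rfl
  | succ k ih =>
    have hder : mder (fun u => f (φ u)) (a 0) = fun u => mder f (ψ (a 0)) (φ u) := by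
      funext u
      simp only [mder, h]
    simp only [mderIter, hder, ih]

lemma chF2_add (a b : ZMod 2) : chF2 (a + b) = chF2 a * chF2 b := by
  rw [chF2, chF2, chF2, ← pow_add, ZMod.val_add, neg_one_pow_eq_pow_mod_two (n := a.val + b.val)]

lemma norm_chF2 (a : ZMod 2) : ‖chF2 a‖ = 1 := by
  simp [chF2]

lemma conj_chF2 (a : ZMod 2) : (starRingEnd ℂ) (chF2 a) = chF2 a := by
  simp [chF2]

lemma IsMultilinear.insertNth_add {V : Type*} [AddCommGroup V] [Module (ZMod 2) V] {k : ℕ}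
    {α : (Fin (k + 1) → V) → ZMod 2} (hα : IsMultilinear (k + 1) α) (i : Fin (k + 1))
    (a : Fin k → V) (u v : V) :
    α (i.insertNth (u + v) a) = α (i.insertNth u a) + α (i.insertNth v a) := by
  simpa using hα.2 i (mem_univ i) (i.insertNth 0 a) u v

/-- The correlation sum of the `k`-fold derivatives of `f` with `(-1) ^ α`, over the coset `y + U`
in the base point and the cosets `w i + U` in the directions. -/
noncomputable def cosetSum {V : Type*} [AddCommGroup V] [Module (ZMod 2) V]
    (U : Submodule (ZMod 2) V) [Fintype U] (k : ℕ) (f : V → ℂ) (α : (Fin k → V) → ZMod 2)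
    (y : V) (w : Fin k → V) : ℂ :=
  ∑ x : U, ∑ a : Fin k → U, mderIter k f (fun i => a i + w i) (x + y) *
    chF2 (α fun i => a i + w i)

section CosetSum

variable {V : Type*} [AddCommGroup V] [Module (ZMod 2) V] (U : Submodule (ZMod 2) V) [Fintype U]

/-- The sum of the derivatives of `f` in directions `a + w` over the coset `y + U`, twisted by the
linear phase obtained from `α` by leaving the `i`-th variable free. -/
noncomputable def linearPhaseSum {k : ℕ} (i : Fin (k + 1)) (f : V → ℂ)
    (α : (Fin (k + 1) → V) → ZMod 2) (w : Fin k → V) (y : V) (a : Fin k → U) : ℂ :=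
  ∑ x : U, mderIter k f (fun j => a j + w j) (x + y) *
    chF2 (α (i.insertNth (x : V) fun j => a j + w j))

lemma cosetSum_insertNth {k : ℕ} (i : Fin (k + 1)) (f : V → ℂ)
    {α : (Fin (k + 1) → V) → ZMod 2} (hα : IsMultilinear (k + 1) α) (y v : V) (w : Fin k → V) :
    cosetSum U (k + 1) f α y (i.insertNth v w) = ∑ a : Fin k → U,
      chF2 (α (i.insertNth v fun j => a j + w j)) *
        (linearPhaseSum U i f α w (y + v) a *
          (starRingEnd ℂ) (linearPhaseSum U i f α w y a)) := by
  have hins (b : U) (a : Fin k → U) :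
      (fun j => ((i.insertNth b a : Fin (k + 1) → U) j : V) + (i.insertNth v w : Fin (k + 1) → V) j)
        = i.insertNth ((b : V) + v) (fun j => (a j : V) + w j) := by
    funext j
    cases j using Fin.succAboveCases i with
    | x => simp
    | p j => simp
  have hsplit (x : U) :
      ∑ a : Fin (k + 1) → U,
        mderIter (k + 1) f (fun j => a j + (i.insertNth v w : Fin (k + 1) → V) j) (x + y) *
          chF2 (α fun j => a j + (i.insertNth v w : Fin (k + 1) → V) j)
      = ∑ a : Fin k → U, ∑ b : U, mder (mderIter k f fun j => a j + w j) (b + v) (x + y) *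
          chF2 (α (i.insertNth ((b : V) + v) fun j => a j + w j)) := by
    rw [← (Fin.insertNthEquiv (fun _ => U) i).sum_comp, Fintype.sum_prod_type, sum_comm]
    refine sum_congr rfl fun a _ => sum_congr rfl fun b _ => ?_
    simp only [Fin.insertNthEquiv_apply, hins, mderIter_insertNth]
  simp only [cosetSum, hsplit]
  rw [sum_comm]
  refine sum_congr rfl fun a _ => ?_
  rw [linearPhaseSum, linearPhaseSum, map_sum, mul_comm (∑ _, _) (∑ _, _), sum_mul, mul_sum]
  refine sum_congr rfl fun x _ => ?_
  rw [← Equiv.sum_comp (Equiv.addLeft x) (fun z : U =>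
    mderIter k f (fun j => a j + w j) (z + (y + v)) *
      chF2 (α (i.insertNth (z : V) fun j => a j + w j))), mul_sum, mul_sum]
  refine sum_congr rfl fun b _ => ?_
  have hsq : chF2 (α (i.insertNth (x : V) fun j => a j + w j)) *
      chF2 (α (i.insertNth (x : V) fun j => a j + w j)) = 1 := by
    rw [← chF2_add, CharTwo.add_self_eq_zero]
    simp [chF2]
  have hpt : (x : V) + y + (b + v) = x + b + (y + v) := by abel
  simp only [mder, map_mul, conj_chF2, Equiv.coe_addLeft, Submodule.coe_add,
    hα.insertNth_add, chF2_add, hpt]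
  linear_combination (-(mderIter k f (fun j => a j + w j) (x + b + (y + v)) *
    (starRingEnd ℂ) (mderIter k f (fun j => a j + w j) (x + y)) *
    chF2 (α (i.insertNth (b : V) fun j => a j + w j)) *
    chF2 (α (i.insertNth v fun j => a j + w j)))) * hsq

lemma cosetSum_insertNth_zero {k : ℕ} (i : Fin (k + 1)) (f : V → ℂ)
    {α : (Fin (k + 1) → V) → ZMod 2} (hα : IsMultilinear (k + 1) α) (y : V) (w : Fin k → V) :
    cosetSum U (k + 1) f α y (i.insertNth 0 w) =
      ((∑ a : Fin k → U, ‖linearPhaseSum U i f α w y a‖ ^ 2 : ℝ) : ℂ) := by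
  rw [cosetSum_insertNth U i f hα, Complex.ofReal_sum]
  refine sum_congr rfl fun a _ => ?_
  have h := hα.insertNth_add i (fun j => (a j : V) + w j) 0 0
  rw [add_zero, left_eq_add] at h
  rw [h, add_zero, Complex.mul_conj']
  simp [chF2]

/-- Cauchy–Schwarz in the `i`-th direction: the shift of that direction can be removed at the cost
of moving the base point. -/
lemma exists_norm_cosetSum_le_update {k : ℕ} (i : Fin k) (f : V → ℂ) {α : (Fin k → V) → ZMod 2}
    (hα : IsMultilinear k α) (y : V) (w : Fin k → V) :
    ∃ y', ‖cosetSum U k f α y w‖ ≤ ‖cosetSum U k f α y' (Function.update w i 0)‖ := by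
  cases k with
  | zero => exact i.elim0
  | succ k =>
    obtain ⟨v, w, rfl⟩ : ∃ v w', w = i.insertNth v w' :=
      ⟨w i, i.removeNth w, (Fin.insertNth_self_removeNth i w).symm⟩
    rw [Fin.update_insertNth]
    have hdiag (z : V) : ‖cosetSum U (k + 1) f α z (i.insertNth 0 w)‖ =
        ∑ a : Fin k → U, ‖linearPhaseSum U i f α w z a‖ ^ 2 := by
      rw [cosetSum_insertNth_zero U i f hα, Complex.norm_real, Real.norm_of_nonneg]
      positivity
    have hmean : 2 * ‖cosetSum U (k + 1) f α y (i.insertNth v w)‖ ≤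
        ‖cosetSum U (k + 1) f α (y + v) (i.insertNth 0 w)‖ +
          ‖cosetSum U (k + 1) f α y (i.insertNth 0 w)‖ := by
      rw [hdiag, hdiag, cosetSum_insertNth U i f hα, ← sum_add_distrib]
      refine (mul_le_mul_of_nonneg_left (norm_sum_le _ _) zero_le_two).trans ?_
      rw [mul_sum]
      refine sum_le_sum fun a _ => ?_
      rw [norm_mul, norm_chF2, one_mul, norm_mul, RCLike.norm_conj, ← mul_assoc]
      exact two_mul_le_add_sq _ _
    by_contra! hlt
    linarith [hlt y, hlt (y + v)]

lemma exists_norm_cosetSum_le_zero {k : ℕ} (f : V → ℂ) {α : (Fin k → V) → ZMod 2}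
    (hα : IsMultilinear k α) (y : V) (w : Fin k → V) :
    ∃ y', ‖cosetSum U k f α y w‖ ≤ ‖cosetSum U k f α y' 0‖ := by
  suffices h : ∀ S : Finset (Fin k),
      ∃ y', ‖cosetSum U k f α y w‖ ≤ ‖cosetSum U k f α y' (S.piecewise 0 w)‖ by
    simpa using h univ
  intro S
  induction S using Finset.induction_on with
  | empty => exact ⟨y, by simp⟩
  | insert i S _ ih =>
    obtain ⟨y₁, h₁⟩ := ih
    obtain ⟨y₂, h₂⟩ := exists_norm_cosetSum_le_update U i f hα y₁ (S.piecewise 0 w)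
    exact ⟨y₂, h₁.trans (by rwa [Finset.piecewise_insert, Pi.zero_apply])⟩

lemma sum_cosetSum [Fintype V] (k : ℕ) (f : V → ℂ) (α : (Fin k → V) → ZMod 2) :
    ∑ y : V, ∑ w : Fin k → V, cosetSum U k f α y w =
      (Fintype.card U : ℂ) ^ (k + 1) *
        ∑ x : V, ∑ a : Fin k → V, mderIter k f a x * chF2 (α a) := by
  have hshift (x : U) (a : Fin k → U) :
      ∑ y : V, ∑ w : Fin k → V, mderIter k f (fun i => a i + w i) (x + y) *
          chF2 (α fun i => a i + w i) =
        ∑ x : V, ∑ a : Fin k → V, mderIter k f a x * chF2 (α a) := by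
    rw [← Equiv.sum_comp (Equiv.addLeft (x : V))
      (fun x => ∑ a : Fin k → V, mderIter k f a x * chF2 (α a))]
    refine sum_congr rfl fun y _ => ?_
    exact Equiv.sum_comp (Equiv.addLeft fun i => (a i : V))
      (fun b => mderIter k f b (x + y) * chF2 (α b))
  calc ∑ y : V, ∑ w : Fin k → V, cosetSum U k f α y w
      = ∑ p : V × (Fin k → V), ∑ q : U × (Fin k → U),
          mderIter k f (fun i => q.2 i + p.2 i) (q.1 + p.1) * chF2 (α fun i => q.2 i + p.2 i) := by
        simp only [cosetSum, Fintype.sum_prod_type]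
    _ = ∑ q : U × (Fin k → U), ∑ x : V, ∑ a : Fin k → V, mderIter k f a x * chF2 (α a) := by
        rw [sum_comm]
        simp only [Fintype.sum_prod_type, hshift]
    _ = _ := by
        simp [pow_succ']

end CosetSum

open scoped Classical in
/-- **Lemma 24 (passing to a subspace).**
If `f : G → 𝔻` correlates (with density `c`) with `(-1)^{α}` along `k`-fold
multiplicative derivatives, then for any subspace `U ≤ G` there is `f̃ : U → 𝔻` which
correlates with `(-1)^{α|_U}` with density at least `c`, over `U`. -/
theorem statement18 (n k : ℕ) (f : (Fin n → ZMod 2) → ℂ) (hf : ∀ x, ‖f x‖ = 1)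
    (α : (Fin k → (Fin n → ZMod 2)) → ZMod 2) (hα : IsMultilinear k α)
    (c : ℝ)
    (hc : c ≤ ‖(∑ x : Fin n → ZMod 2, ∑ a : Fin k → Fin n → ZMod 2,
        mderIter k f a x * chF2 (α a)) /
      ((Fintype.card (Fin n → ZMod 2) : ℂ)) ^ (k + 1)‖)
    (U : Submodule (ZMod 2) (Fin n → ZMod 2)) :
    ∃ g : U → ℂ, (∀ x, ‖g x‖ = 1) ∧
      c ≤ ‖(∑ x : U, ∑ a : Fin k → U,
          mderIter k g a x * chF2 (α fun i => (a i : Fin n → ZMod 2))) /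
        ((Fintype.card U : ℂ)) ^ (k + 1)‖ := by
  obtain ⟨y, w, hyw⟩ : ∃ y w, c * (Fintype.card U : ℝ) ^ (k + 1) ≤ ‖cosetSum U k f α y w‖ := by
    by_contra! hlt
    rw [norm_div, norm_pow, Complex.norm_natCast, le_div_iff₀ (by positivity)] at hc
    have hsum := congrArg norm (sum_cosetSum U k f α)
    rw [norm_mul, norm_pow, Complex.norm_natCast, ← Fintype.sum_prod_type'] at hsum
    have hupper : ‖∑ p : (Fin n → ZMod 2) × (Fin k → Fin n → ZMod 2),
        cosetSum U k f α p.1 p.2‖ <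
        (Fintype.card (Fin n → ZMod 2) : ℝ) ^ (k + 1) * (c * (Fintype.card U : ℝ) ^ (k + 1)) := by
      refine (norm_sum_le _ _).trans_lt ?_
      refine (sum_lt_sum_of_nonempty univ_nonempty fun p _ => hlt p.1 p.2).trans_eq ?_
      simp [pow_succ', mul_assoc]
    rw [hsum] at hupper
    have := mul_le_mul_of_nonneg_left hc
      (by positivity : (0 : ℝ) ≤ (Fintype.card U : ℝ) ^ (k + 1))
    linarith
  obtain ⟨z, hz⟩ := exists_norm_cosetSum_le_zero U f hα y w
  refine ⟨fun u => f (u + z), fun u => hf _, ?_⟩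
  rw [norm_div, norm_pow, Complex.norm_natCast, le_div_iff₀ (by positivity)]
  refine (hyw.trans hz).trans_eq ?_
  simp only [cosetSum, Pi.zero_apply, add_zero]
  have hcomp (x : U) (a : Fin k → U) := mderIter_comp (fun u : U => (u : Fin n → ZMod 2) + z)
    (fun u => (u : Fin n → ZMod 2)) (fun x a => by simp [add_right_comm]) k f a x
  simp only [hcomp]
end

section
/- Suppose σ : G^k → 𝔽₂ is a strongly symmetric multilinear form. Then there exists a strongly symmetric multilinear form σ̃ : G^{k+1} → 𝔽₂ such that σ(x₁, x₂, …, x_k) = σ̃(x₁, x₁, x₂, …, x_k) for all x₁, …, x_k ∈ G. -/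
open Finset

section Multiplicity

variable {ι α β : Type*} [Fintype ι] [DecidableEq ι] [DecidableEq α]

/-- The number of times the tuple `I` takes the value `c`. -/
def tupleCount (I : ι → α) (c : α) : ℕ := #{i | I i = c}

lemma tupleCount_update (I : ι → α) (i : ι) (b c : α) :
    tupleCount (Function.update I i b) c + (if I i = c then 1 else 0) =
      tupleCount I c + (if b = c then 1 else 0) := by
  simp only [tupleCount, Finset.card_filter]
  rw [← Finset.add_sum_erase _ _ (Finset.mem_univ i),
    ← Finset.add_sum_erase univ (fun j => if I j = c then 1 else 0) (Finset.mem_univ i)]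
  have : ∑ j ∈ univ.erase i, (if Function.update I i b j = c then 1 else 0) =
      ∑ j ∈ univ.erase i, (if I j = c then 1 else 0) :=
    Finset.sum_congr rfl fun j hj => by
      rw [Function.update_of_ne (Finset.ne_of_mem_erase hj)]
  rw [this, Function.update_self]
  omega

omit [DecidableEq ι] in
lemma tupleCount_pos {I : ι → α} {c : α} : 0 < tupleCount I c ↔ ∃ i, I i = c := by
  simp [tupleCount, Finset.card_pos, Finset.Nonempty]

omit [DecidableEq ι] in
lemma exists_perm_of_tupleCount_eq {I I' : ι → α}
    (h : ∀ c, tupleCount I c = tupleCount I' c) : ∃ π : Equiv.Perm ι, I = I' ∘ π := by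
  have hcard : ∀ c, Nonempty ({i // I i = c} ≃ {i // I' i = c}) := fun c =>
    Fintype.card_eq.1 (by simpa [tupleCount, Fintype.card_subtype] using h c)
  have e := fun c => (hcard c).some
  exact ⟨Equiv.ofFiberEquiv e, funext fun i => (Equiv.ofFiberEquiv_map e i).symm⟩

variable [Fintype α]

omit [DecidableEq ι] in
lemma sum_tupleCount (I : ι → α) : ∑ c, tupleCount I c = Fintype.card ι := by
  simp only [tupleCount]
  rw [← Finset.card_univ]
  exact (Finset.card_eq_sum_card_fiberwise (fun _ _ => Finset.mem_coe.2 (Finset.mem_univ _))).symm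

/-- A permutation invariant function of tuples that allows replacing a repeated entry by another
entry of the tuple depends only on the set of entries. -/
lemma eq_of_image_eq {h : (ι → α) → β} (hperm : ∀ (π : Equiv.Perm ι) I, h (I ∘ π) = h I)
    (hexch : ∀ (I : ι → α) (i j l : ι), i ≠ j → l ≠ i → l ≠ j → I i = I j →
      h I = h (Function.update I i (I l)))
    {I I' : ι → α} (hI : univ.image I = univ.image I') : h I = h I' := by
  induction hD : ∑ c, (tupleCount I c - tupleCount I' c) using Nat.strong_induction_on
    generalizing I with
  | _ D ih =>
  have hpos : ∀ c, 0 < tupleCount I c ↔ 0 < tupleCount I' c := fun c => by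
    have := congrArg (c ∈ ·) hI
    simpa [tupleCount_pos] using this
  have hsum : ∑ c, tupleCount I c = ∑ c, tupleCount I' c := by
    rw [sum_tupleCount, sum_tupleCount]
  by_cases hle : ∀ c, tupleCount I c ≤ tupleCount I' c
  · have heq := (Finset.sum_eq_sum_iff_of_le fun c _ => hle c).1 hsum
    obtain ⟨π, rfl⟩ := exists_perm_of_tupleCount_eq fun c => heq c (Finset.mem_univ c)
    exact hperm π I'
  push Not at hle
  obtain ⟨a, ha⟩ := hle
  obtain ⟨b, hb⟩ : ∃ b, tupleCount I b < tupleCount I' b := by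
    by_contra! hge
    exact (Finset.sum_lt_sum (fun c _ => hge c) ⟨a, Finset.mem_univ a, ha⟩).ne' hsum
  have ha' := (hpos a).1 (by omega)
  have hb' := (hpos b).2 (by omega)
  have hab : a ≠ b := by rintro rfl; omega
  obtain ⟨l, rfl⟩ := tupleCount_pos.1 hb'
  obtain ⟨i, hi, j, hj, hij⟩ := Finset.one_lt_card.1 (show 1 < #{i | I i = a} from by
    change 1 < tupleCount I a; omega)
  simp only [Finset.mem_filter, Finset.mem_univ, true_and] at hi hj
  rw [hexch I i j l hij (by rintro rfl; exact hab hi.symm) (by rintro rfl; exact hab hj.symm)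
    (hi.trans hj.symm)]
  have hupd := tupleCount_update I i (I l)
  refine ih _ ?_ ?_ rfl
  · rw [← hD]
    refine Finset.sum_lt_sum (fun c _ => ?_) ⟨a, Finset.mem_univ a, ?_⟩
    · have := hupd c
      split_ifs at this with h1 h2 h2
      · omega
      · omega
      · subst h2; omega
      · omega
    · have := hupd a
      rw [if_pos hi, if_neg hab.symm] at this
      omega
  · rw [← hI]
    ext c
    simp only [Finset.mem_image, Finset.mem_univ, true_and]
    rw [← tupleCount_pos, ← tupleCount_pos]
    have := hupd c
    split_ifs at this with h1 h2 h2
    · omega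
    · have : c = a := h1.symm.trans hi
      subst this
      omega
    · subst h2; omega
    · omega

end Multiplicity

section BasisExpansion

variable {k n : ℕ}

/-- The value of a strongly symmetric form is unchanged when one of two equal arguments is replaced
by another argument. -/
lemma StronglySymmetric.exchange {V : Type*} {σ : (Fin k → V) → ZMod 2}
    (hσ : StronglySymmetric k σ) (x : Fin k → V) {i j l : Fin k} (hij : i ≠ j) (hli : l ≠ i)
    (hlj : l ≠ j) (hx : x i = x j) : σ x = σ (Function.update x i (x l)) := by
  have hk : 3 ≤ k := by
    simpa [Finset.card_eq_three.2 ⟨i, j, l, hij, hli.symm, hlj.symm, rfl⟩] using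
      Finset.card_le_univ ({i, j, l} : Finset (Fin k))
  obtain ⟨m, rfl⟩ := Nat.exists_eq_add_of_le' hk
  have hperm : ∀ (π : Equiv.Perm (Fin (m + 3))) y, σ (fun t => y (π t)) = σ y := fun π y => by
    simpa [permForm] using congrFun (hσ.1 π.symm) y
  obtain ⟨π, h0, h1, h2⟩ : ∃ π : Equiv.Perm (Fin (m + 3)), π 0 = i ∧
      π 1 = j ∧ π ⟨2, by omega⟩ = l := by
    have hsrc : Function.Injective ![(0 : Fin (m + 3)), ⟨1, by omega⟩, ⟨2, by omega⟩] := by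
      intro a b; fin_cases a <;> fin_cases b <;> simp [Fin.ext_iff]
    have htgt : Function.Injective ![i, j, l] := by
      intro a b; fin_cases a <;> fin_cases b <;> simp [*, Ne.symm]
    have := Equiv.Perm.isMultiplyPretransitive (Fin (m + 3)) 3
    obtain ⟨π, hπ⟩ := MulAction.exists_smul_eq (Equiv.Perm (Fin (m + 3)))
      (⟨_, hsrc⟩ : Fin 3 ↪ Fin (m + 3)) ⟨_, htgt⟩
    exact ⟨π, DFunLike.congr_fun hπ 0, DFunLike.congr_fun hπ 1, DFunLike.congr_fun hπ 2⟩
  rw [← hperm π x, ← hperm (π * Equiv.swap 1 ⟨2, by omega⟩) (Function.update x i (x l))]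
  convert hσ.2 (x i) (x l) (fun t => x (π t)) using 2 <;> ext t : 1 <;>
    obtain ⟨_ | _ | _ | t, ht⟩ := t
  · exact congrArg x h0
  · exact (congrArg x h1).trans hx.symm
  · exact congrArg x h2
  · simp
  · have : (⟨0, ht⟩ : Fin (m + 3)) = 0 := rfl
    simp [Equiv.swap_apply_of_ne_of_ne, this, h0]
  · simp [h2, Function.update_of_ne hli]
  · simp [h1, Function.update_of_ne hij.symm, hx]
  · have hne : π ⟨t + 3, ht⟩ ≠ i := by
      rw [← h0, π.injective.ne_iff]; simp [Fin.ext_iff]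
    simp [Equiv.swap_apply_of_ne_of_ne, Function.update_of_ne hne]

/-- A multilinear form as a `MultilinearMap`. -/
def IsMultilinear.toMultilinearMap {V : Type*} [AddCommGroup V] [Module (ZMod 2) V]
    {σ : (Fin k → V) → ZMod 2} (hσ : IsMultilinear k σ) :
    MultilinearMap (ZMod 2) (fun _ : Fin k => V) (ZMod 2) where
  toFun := σ
  map_update_add' := by
    intro inst x i u v
    obtain rfl := Subsingleton.elim inst (instDecidableEqFin k)
    exact hσ.2 i (Finset.mem_univ i) x u v
  map_update_smul' := by
    intro inst x i c u
    obtain rfl := Subsingleton.elim inst (instDecidableEqFin k)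
    have h0 : σ (Function.update x i 0) = 0 := by
      simpa using hσ.2 i (Finset.mem_univ i) x 0 0
    obtain rfl | rfl : c = 0 ∨ c = 1 := by revert c; decide
    · simpa using h0
    · simp

/-- The value of a multilinear form in terms of its values on the standard basis. -/
lemma IsMultilinear.eq_sum {σ : (Fin k → (Fin n → ZMod 2)) → ZMod 2} (hσ : IsMultilinear k σ)
    (x : Fin k → (Fin n → ZMod 2)) :
    σ x = ∑ I : Fin k → Fin n, σ (fun i => Pi.single (I i) 1) * ∏ i, x i (I i) := by
  have h : σ x = hσ.toMultilinearMap (fun i => ∑ j, x i j • Pi.single j (1 : ZMod 2)) := by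
    change σ x = σ _
    congr 1
    ext i j
    simp [Finset.sum_apply, Pi.single_apply]
  rw [h, MultilinearMap.map_sum]
  refine Finset.sum_congr rfl fun I _ => ?_
  rw [MultilinearMap.map_smul_univ, smul_eq_mul, mul_comm]
  rfl

/-- The form whose value at `(e_{J 1}, …, e_{J k})` is `g {J 1, …, J k}`. -/
def supportForm (k : ℕ) (g : Finset (Fin n) → ZMod 2) (x : Fin k → (Fin n → ZMod 2)) : ZMod 2 :=
  ∑ J : Fin k → Fin n, g (univ.image J) * ∏ i, x i (J i)

variable (g : Finset (Fin n) → ZMod 2)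

lemma isMultilinear_supportForm : IsMultilinear k (supportForm k g) := by
  refine ⟨fun x y h => by rw [funext fun i => h i (Finset.mem_univ i)], fun i _ x u v => ?_⟩
  simp only [supportForm]
  rw [← Finset.sum_add_distrib]
  refine Finset.sum_congr rfl fun J _ => ?_
  have hprod : ∀ w : Fin n → ZMod 2, ∏ t, Function.update x i w t (J t) =
      w (J i) * ∏ t ∈ univ.erase i, x t (J t) := fun w => by
    rw [← Finset.mul_prod_erase _ _ (Finset.mem_univ i), Function.update_self]
    congr 1
    exact Finset.prod_congr rfl fun t ht => by
      rw [Function.update_of_ne (Finset.ne_of_mem_erase ht)]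
  rw [hprod, hprod, hprod, Pi.add_apply]
  ring

lemma symmetricForm_supportForm : SymmetricForm k (supportForm k g) := by
  intro π
  ext x
  simp only [permForm, supportForm]
  refine Fintype.sum_equiv (Equiv.arrowCongr π.symm (Equiv.refl _)) _ _ fun J => ?_
  have himage : univ.image (J ∘ π) = univ.image J := by
    rw [← Finset.image_image, Finset.image_univ_equiv]
  change _ = g (univ.image (J ∘ π)) * ∏ i, x i (J (π i))
  rw [himage]
  congr 1
  exact Fintype.prod_equiv π.symm _ _ fun t => by simp

/-- In `supportForm`, when two arguments coincide, only the tuples with equal indices at the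
corresponding positions contribute. -/
lemma supportForm_eq_sum_filter {x : Fin k → (Fin n → ZMod 2)} {i j : Fin k} (hx : x i = x j) :
    supportForm k g x =
      ∑ J : Fin k → Fin n with J i = J j, g (univ.image J) * ∏ t, x t (J t) := by
  rw [supportForm, ← Finset.sum_filter_add_sum_filter_not univ (fun J => J i = J j),
    add_eq_left]
  have hswap : ∀ t, x (Equiv.swap i j t) = x t := fun t => by
    rcases eq_or_ne t i with rfl | hti
    · rw [Equiv.swap_apply_left, hx]
    rcases eq_or_ne t j with rfl | htj
    · rw [Equiv.swap_apply_right, hx]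
    · rw [Equiv.swap_apply_of_ne_of_ne hti htj]
  refine Finset.sum_involution (fun J _ => J ∘ Equiv.swap i j) ?_ ?_ ?_ ?_
  · intro J _
    have himage : univ.image (J ∘ Equiv.swap i j) = univ.image J := by
      rw [← Finset.image_image, Finset.image_univ_equiv]
    have hprod : ∏ t, x t ((J ∘ Equiv.swap i j) t) = ∏ t, x t (J t) :=
      Fintype.prod_equiv (Equiv.swap i j) _ _ fun t => by rw [hswap]; rfl
    rw [himage, hprod, CharTwo.add_self_eq_zero]
  · intro J hJ _ h
    simp only [Finset.mem_filter, Finset.mem_univ, true_and] at hJ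
    apply hJ
    simpa using congrFun h j
  · intro J hJ
    simp only [Finset.mem_filter, Finset.mem_univ, true_and, Function.comp_apply,
      Equiv.swap_apply_left, Equiv.swap_apply_right] at hJ ⊢
    exact Ne.symm hJ
  · intro J _
    ext t
    simp

lemma zmod_two_mul_self (a : ZMod 2) : a * a = a := by
  revert a; decide

lemma stronglySymmetric_supportForm (hk : 3 ≤ k) : StronglySymmetric k (supportForm k g) := by
  refine ⟨symmetricForm_supportForm g, fun u v z => ?_⟩
  obtain ⟨m, rfl⟩ := Nat.exists_eq_add_of_le' hk
  rw [supportForm_eq_sum_filter g (i := 0) (j := 1) (by simp),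
    supportForm_eq_sum_filter g (i := 0) (j := 1) (by simp)]
  let e : (Fin (m + 3) → Fin n) → (Fin (m + 3) → Fin n) :=
    fun J => Fin.cons (J 2) (Fin.cons (J 2) (Fin.cons (J 0) fun t => J t.succ.succ.succ))
  have hmem : ∀ J : Fin (m + 3) → Fin n, e J 0 = e J 1 := fun J => rfl
  have hinv : ∀ J : Fin (m + 3) → Fin n, J 0 = J 1 → e (e J) = J := fun J hJ => by
    ext t
    refine Fin.cases rfl (fun t => Fin.cases (congrArg _ hJ) (fun t => Fin.cases rfl
      (fun t => rfl) t) t) t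
  refine Finset.sum_bij' (fun J _ => e J) (fun J _ => e J) ?_ ?_ ?_ ?_ ?_
  · intro J _; simpa using hmem J
  · intro J _; simpa using hmem J
  · intro J hJ; exact hinv J (by simpa using hJ)
  · intro J hJ; exact hinv J (by simpa using hJ)
  · intro J hJ
    have hJ' : J 0 = J 1 := by simpa using hJ
    have himage : univ.image (e J) = univ.image J := by
      ext c
      simp only [Finset.mem_image, Finset.mem_univ, true_and, Fin.exists_fin_succ]
      change (J 2 = c ∨ J 2 = c ∨ J 0 = c ∨ _) ↔ (J 0 = c ∨ J 1 = c ∨ J 2 = c ∨ _)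
      rw [← hJ']
      tauto
    rw [himage]
    congr 1
    simp only [Fin.prod_univ_succ]
    change u (J 0) * (u (J 1) * (v (J 2) * _)) = v (J 2) * (v (J 2) * (u (J 0) * _))
    rw [← hJ', ← mul_assoc, ← mul_assoc (v (J 2)), zmod_two_mul_self, zmod_two_mul_self]
    rw [mul_left_comm]
    rfl

end BasisExpansion

/-- **Lemma 25 (lifting strongly symmetric forms).**
Every strongly symmetric multilinear form `σ : G^k → 𝔽₂` is the diagonal restriction
`σ(x₁, …, x_k) = σ̃(x₁, x₁, x₂, …, x_k)` of a strongly symmetric multilinear form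
`σ̃ : G^{k+1} → 𝔽₂`. -/
theorem statement19 (n k : ℕ) (hk : 1 ≤ k)
    (σ : (Fin k → (Fin n → ZMod 2)) → ZMod 2)
    (hσ : IsMultilinear k σ) (hss : StronglySymmetric k σ) :
    ∃ τ : (Fin (k + 1) → (Fin n → ZMod 2)) → ZMod 2,
      IsMultilinear (k + 1) τ ∧ StronglySymmetric (k + 1) τ ∧
      ∀ x : Fin k → (Fin n → ZMod 2),
        σ x = τ (fun i => x ⟨(i : ℕ) - 1, by have := i.isLt; omega⟩) := by
  obtain ⟨m, rfl⟩ := Nat.exists_eq_add_of_le' hk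
  rcases Nat.eq_zero_or_pos m with rfl | hm
  · have hzero : ∀ x, σ x = 0 := fun x => by
      have hx0 : σ (fun _ => 0) = 0 :=
        hσ.toMultilinearMap.map_coord_zero (m := fun _ => 0) 0 rfl
      have h := hss.2 (x 0) 0 x
      have hxx : x = fun _ => x 0 := by ext i; rw [Subsingleton.elim (α := Fin 1) i 0]
      rw [hxx]
      simpa [hx0] using h
    exact ⟨fun _ => 0, ⟨fun _ _ _ => rfl, fun _ _ _ _ _ => by simp⟩,
      ⟨fun _ => rfl, fun _ _ _ => rfl⟩, hzero⟩
  let h : (Fin (m + 1) → Fin n) → ZMod 2 := fun I => σ fun i => Pi.single (I i) 1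
  have himage : ∀ {I I'}, univ.image I = univ.image I' → h I = h I' :=
    eq_of_image_eq
      (fun π I => by
        simpa [h, permForm] using congrFun (hss.1 π.symm) fun i => Pi.single (I i) 1)
      (fun I i j l hij hli hlj hI => by
        refine (hss.exchange _ hij hli hlj (by rw [hI])).trans (congrArg σ ?_)
        ext t : 1
        rcases eq_or_ne t i with rfl | ht <;> simp [*])
  let g : Finset (Fin n) → ZMod 2 := Function.extend (fun I => univ.image I) h 0
  have hg : ∀ I, g (univ.image I) = h I := fun I =>
    Function.FactorsThrough.extend_apply (fun _ _ => himage) 0 I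
  refine ⟨supportForm (m + 1 + 1) g, isMultilinear_supportForm g,
    stronglySymmetric_supportForm g (by omega), fun x => ?_⟩
  rw [supportForm_eq_sum_filter g (i := 0) (j := 1) rfl, hσ.eq_sum]
  refine Finset.sum_bij' (fun I _ => Fin.cons (I 0) I) (fun J _ => Fin.tail J) ?_ ?_ ?_ ?_ ?_
  · intro I _
    simp only [Finset.mem_filter, Finset.mem_univ, true_and]
    rfl
  · intro J _
    exact Finset.mem_univ _
  · intro I _
    rfl
  · intro J hJ
    have hJ' : J 1 = J 0 := by simpa using Eq.symm (Finset.mem_filter.1 hJ).2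
    ext t
    exact Fin.cases (congrArg _ hJ') (fun _ => rfl) t
  · intro I _
    have hI : univ.image (Fin.cons (I 0) I : Fin (m + 1 + 1) → Fin n) = univ.image I := by
      ext c
      simp only [Finset.mem_image, Finset.mem_univ, true_and, Fin.exists_fin_succ (n := m + 1),
        Fin.cons_zero, Fin.cons_succ]
      exact or_iff_right_of_imp fun h => ⟨0, h⟩
    rw [hI, hg]
    congr 1
    rw [Fin.prod_univ_succ, Fin.prod_univ_succ]
    conv_rhs => rw [Fin.prod_univ_succ]
    simp only [Fin.cons_zero, Fin.cons_succ]
    rw [← mul_assoc]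
    exact congrArg (· * _) (zmod_two_mul_self _).symm
end
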